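/- arXiv:2206.04387 — 2 statements merged into one kernel-verified Lean document; each statement's English description precedes it below -/
import Mathlib

section
/- Let G be a connected graph with disjoint vertex sets S, T ⊆ V(G), and suppose every minimum feedback vertex set X of G misses some vertex of S or leaves two vertices of T connected in G − X. Then there exist subsets S* ⊆ S and T* ⊆ T whose sizes are bounded by a function of the elimination distance of G to a forest (i.e., there is a function γ : ℕ → ℕ, independent of G, S, T, with |S*| ≤ γ(ed_{𝒢F}(G)) and |T*| ≤ γ(ed_{𝒢F}(G))), such that every minimum feedback vertex set X of G misses some vertex of S* or leaves two vertices of T* connected in G − X. -/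
/-- `X` is a feedback vertex set of `G`: removing `X` leaves an acyclic graph. -/
def IsFVS {V : Type} (G : SimpleGraph V) (X : Set V) : Prop :=
  (G.induce Xᶜ).IsAcyclic

/-- `X` is a minimum feedback vertex set of `G`. -/
def IsMinFVS {V : Type} (G : SimpleGraph V) (X : Set V) : Prop :=
  IsFVS G X ∧ ∀ Y : Set V, IsFVS G Y → X.ncard ≤ Y.ncard

/-- Every connected component of `G[A]` contains at most one vertex of `T`. -/
def SeparatedIn {V : Type} (G : SimpleGraph V) (A T : Set V) : Prop :=
  ∀ (t₁ t₂ : V) (h₁ : t₁ ∈ A) (h₂ : t₂ ∈ A), t₁ ∈ T → t₂ ∈ T →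
    (G.induce A).Reachable ⟨t₁, h₁⟩ ⟨t₂, h₂⟩ → t₁ = t₂

/-- `X` misses some vertex of `S`, or leaves two vertices of `T` connected in `G - X`. -/
def BadFor {V : Type} (G : SimpleGraph V) (S T X : Set V) : Prop :=
  (¬ S ⊆ X) ∨ ¬ SeparatedIn G Xᶜ T

/-- `ElimLE G Base A k` holds iff the elimination distance of `G[A]` to the class of
graphs described by the base predicate `Base` is at most `k`: either the base predicate
already holds, or from each connected component one vertex can be deleted so that the
remainder has elimination distance at most `k - 1`. -/
inductive ElimLE {V : Type} (G : SimpleGraph V) (Base : Set V → Prop) : Set V → ℕ → Prop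
  | base (A : Set V) (k : ℕ) (h : Base A) : ElimLE G Base A k
  | step (A : Set V) (k : ℕ)
      (v : (G.induce A).ConnectedComponent → ↥A)
      (hv : ∀ C : (G.induce A).ConnectedComponent, v C ∈ C.supp)
      (h : ∀ C : (G.induce A).ConnectedComponent,
        ElimLE G Base ((Subtype.val '' C.supp) \ {(v C).val}) k) :
      ElimLE G Base A (k + 1)

/-- The elimination distance of `G` to a forest. -/
noncomputable def edForest {V : Type} (G : SimpleGraph V) : ℕ :=
  sInf {k | ElimLE G (fun A => (G.induce A).IsAcyclic) Set.univ k}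

namespace FV

section graphs
variable {W : Type}

/-- Generic induction along reachability. -/
theorem reach_ind {H : SimpleGraph W} {P : W → Prop} {a b : W} (h : H.Reachable a b) (ha : P a)
    (step : ∀ x y, P x → H.Adj x y → P y) : P b := by
  obtain ⟨p⟩ := h
  induction p with
  | nil => exact ha
  | cons hadj _ ih => exact ih (step _ _ ha hadj)

/-- Edges of `H` with both ends in `B`. -/
def inn (H : SimpleGraph W) (B : Set W) : SimpleGraph W where
  Adj a b := H.Adj a b ∧ a ∈ B ∧ b ∈ B
  symm := ⟨fun _ _ h => ⟨h.1.symm, h.2.2, h.2.1⟩⟩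
  loopless := ⟨fun _ h => H.loopless.irrefl _ h.1⟩

/-- Edges of `H` with some end in `D`. -/
def touch (H : SimpleGraph W) (D : Set W) : SimpleGraph W where
  Adj a b := H.Adj a b ∧ (a ∈ D ∨ b ∈ D)
  symm := ⟨fun _ _ h => ⟨h.1.symm, h.2.symm⟩⟩
  loopless := ⟨fun _ h => H.loopless.irrefl _ h.1⟩

theorem inn_adj {H : SimpleGraph W} {B : Set W} {a b : W} :
    (inn H B).Adj a b ↔ H.Adj a b ∧ a ∈ B ∧ b ∈ B := Iff.rfl

theorem touch_adj {H : SimpleGraph W} {B : Set W} {a b : W} :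
    (touch H B).Adj a b ↔ H.Adj a b ∧ (a ∈ B ∨ b ∈ B) := Iff.rfl

/-- Each component of `F` has at most one vertex in `U`. -/
def SepOn (F : SimpleGraph W) (U : Set W) : Prop :=
  ∀ a b, a ∈ U → b ∈ U → F.Reachable a b → a = b

theorem inn_mono {H H' : SimpleGraph W} {B B' : Set W} (h : H ≤ H') (hB : B ⊆ B') :
    inn H B ≤ inn H' B' := fun _ _ hh => ⟨h hh.1, hB hh.2.1, hB hh.2.2⟩

theorem inn_le {H : SimpleGraph W} {B : Set W} : inn H B ≤ H := fun _ _ hh => hh.1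

theorem touch_le {H : SimpleGraph W} {B : Set W} : touch H B ≤ H := fun _ _ hh => hh.1

/-- Vertices reachable by a nontrivial walk have a neighbour. -/
theorem exists_adj_of_reachable {H : SimpleGraph W} {a b : W} (h : H.Reachable a b) (hne : a ≠ b) :
    ∃ c, H.Adj a c := by
  obtain ⟨p⟩ := h
  cases p with
  | nil => exact absurd rfl hne
  | cons hadj _ => exact ⟨_, hadj⟩

theorem reach_sup {F0 F1 : SimpleGraph W} {U : Set W}
    (h0 : ∀ a b, F0.Adj a b → a ∈ U ∧ b ∈ U) (hs : SepOn F1 U) {x y : W}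
    (h : (F0 ⊔ F1).Reachable x y) :
    F1.Reachable x y ∨
      ∃ w w', w ∈ U ∧ w' ∈ U ∧ F1.Reachable x w ∧ F0.Reachable w w' ∧ F1.Reachable w' y := by
  refine reach_ind (P := fun y => F1.Reachable x y ∨
      ∃ w w', w ∈ U ∧ w' ∈ U ∧ F1.Reachable x w ∧ F0.Reachable w w' ∧ F1.Reachable w' y) h
      (Or.inl (SimpleGraph.Reachable.refl x)) ?_
  rintro y z hy (hadj | hadj)
  · obtain ⟨yU, zU⟩ := h0 _ _ hadj
    rcases hy with hy | ⟨w, w', hw, hw', h1, h2, h3⟩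
    · exact Or.inr ⟨y, z, yU, zU, hy, hadj.reachable, SimpleGraph.Reachable.refl _⟩
    · obtain rfl := hs _ _ hw' yU h3
      exact Or.inr ⟨w, z, hw, zU, h1, h2.trans hadj.reachable, SimpleGraph.Reachable.refl _⟩
  · rcases hy with hy | ⟨w, w', hw, hw', h1, h2, h3⟩
    · exact Or.inl (hy.trans hadj.reachable)
    · exact Or.inr ⟨w, w', hw, hw', h1, h2, h3.trans hadj.reachable⟩

/-- Gluing forests. -/
theorem glue {F0 F1 : SimpleGraph W} {U : Set W} (a0 : F0.IsAcyclic) (a1 : F1.IsAcyclic)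
    (h0 : ∀ a b, F0.Adj a b → a ∈ U ∧ b ∈ U) (hs : SepOn F1 U) : (F0 ⊔ F1).IsAcyclic := by
  rw [SimpleGraph.isAcyclic_iff_forall_adj_isBridge] at a0 a1 ⊢
  intro x y hxy
  rw [SimpleGraph.isBridge_iff]
  intro hr
  set e : Set (Sym2 W) := {s(x, y)} with he
  have hr' : (F0.deleteEdges e ⊔ F1.deleteEdges e).Reachable x y := by
    refine hr.mono ?_
    intro a b hab
    simp only [SimpleGraph.deleteEdges_adj, SimpleGraph.sup_adj] at hab ⊢
    tauto
  have hs' : SepOn (F1.deleteEdges e) U := fun a b ha hb h =>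
    hs a b ha hb (h.mono (SimpleGraph.deleteEdges_le _))
  have h0' : ∀ a b, (F0.deleteEdges e).Adj a b → a ∈ U ∧ b ∈ U := fun a b h =>
    h0 a b (SimpleGraph.deleteEdges_le _ h)
  have key := reach_sup h0' hs' hr'
  rcases hxy with hxy | hxy
  · obtain ⟨xU, yU⟩ := h0 _ _ hxy
    rcases key with h | ⟨w, w', hw, hw', h1, h2, h3⟩
    · exact hxy.ne (hs' _ _ xU yU h)
    · obtain rfl := hs' _ _ xU hw h1
      obtain rfl := hs' _ _ hw' yU h3
      exact a0 hxy h2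
  · rcases key with h | ⟨w, w', hw, hw', h1, h2, h3⟩
    · exact a1 hxy h
    · have l := SimpleGraph.deleteEdges_le (G := F1) e
      obtain rfl := hs _ _ hw hw' (((h1.mono l).symm.trans hxy.reachable).trans (h3.mono l).symm)
      exact a1 hxy (h1.trans h3)

/-- Two edge-disjoint subgraphs of a forest cannot both connect two distinct vertices. -/
theorem edge_disjoint_conn {F A B : SimpleGraph W} (hF : F.IsAcyclic) (hA : A ≤ F) (hB : B ≤ F)
    (hd : ∀ x y, A.Adj x y → B.Adj x y → False) {a b : W} (ha : A.Reachable a b)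
    (hb : B.Reachable a b) : a = b := by
  classical
  obtain ⟨p⟩ := ha
  obtain ⟨q⟩ := hb
  by_contra hne
  have hp := p.toPath.2
  have hq := q.toPath.2
  have e := (hF.subsingleton_path a b).elim ⟨(p.toPath : A.Walk a b).mapLe hA, hp.mapLe hA⟩
    ⟨(q.toPath : B.Walk a b).mapLe hB, hq.mapLe hB⟩
  have e2 := congrArg (fun r : F.Path a b => (r : F.Walk a b).edges) e
  simp only [SimpleGraph.Walk.edges_mapLe_eq_edges] at e2
  generalize (p.toPath : A.Walk a b) = p' at e2
  generalize (q.toPath : B.Walk a b) = q' at e2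
  cases p' with
  | nil => exact hne rfl
  | cons hadj p'' =>
    rename_i v
    have hm : s(a, v) ∈ q'.edges := by rw [← e2]; simp
    exact hd _ _ hadj (SimpleGraph.Walk.adj_of_mem_edges q' hm)

/-- Replacing what happens inside `D`. -/
theorem split_acyclic {F : SimpleGraph W} {D : Set W} (h0 : (inn F Dᶜ).IsAcyclic)
    (h1 : (touch F D).IsAcyclic) (hs : SepOn (touch F D) Dᶜ) : F.IsAcyclic := by
  refine SimpleGraph.IsAcyclic.anti ?_ (glue h0 h1 (fun a b h => h.2) hs)
  intro a b hab
  by_cases h : a ∈ D ∨ b ∈ D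
  · exact Or.inr ⟨hab, h⟩
  · push Not at h
    exact Or.inl ⟨hab, h.1, h.2⟩

theorem inn_reach_mem {H : SimpleGraph W} {B : Set W} {a b : W} (ha : a ∈ B)
    (h : (inn H B).Reachable a b) : b ∈ B :=
  reach_ind (P := fun b => b ∈ B) h ha (fun _ _ _ hh => hh.2.2)

theorem reach_induce {H : SimpleGraph W} {B : Set W} {a b : W} (ha : a ∈ B)
    (h : (inn H B).Reachable a b) : ∃ hb : b ∈ B, (H.induce B).Reachable ⟨a, ha⟩ ⟨b, hb⟩ := by
  refine reach_ind (P := fun b => ∃ hb : b ∈ B, (H.induce B).Reachable ⟨a, ha⟩ ⟨b, hb⟩) h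
    ⟨ha, SimpleGraph.Reachable.refl _⟩ ?_
  rintro x y ⟨hx, hr⟩ hxy
  refine ⟨hxy.2.2, hr.trans (SimpleGraph.Adj.reachable ?_)⟩
  exact hxy.1

theorem induce_reach {H : SimpleGraph W} {B : Set W} {a b : B}
    (h : (H.induce B).Reachable a b) : (inn H B).Reachable a.1 b.1 := by
  refine reach_ind (P := fun b : B => (inn H B).Reachable a.1 b.1) h
    (SimpleGraph.Reachable.refl _) ?_
  intro x y hx hxy
  exact hx.trans (SimpleGraph.Adj.reachable ⟨hxy, x.2, y.2⟩)

theorem induce_acyclic_iff {H : SimpleGraph W} {B : Set W} :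
    (H.induce B).IsAcyclic ↔ (inn H B).IsAcyclic := by
  constructor
  · intro h
    rw [SimpleGraph.isAcyclic_iff_forall_adj_isBridge] at h ⊢
    intro x y hxy
    have hb := h (v := ⟨x, hxy.2.1⟩) (w := ⟨y, hxy.2.2⟩) hxy.1
    rw [SimpleGraph.isBridge_iff] at hb ⊢
    intro hr
    apply hb
    have hr' : (inn (H.deleteEdges {s(x, y)}) B).Reachable x y := by
      refine hr.mono ?_
      intro a b hab
      simp only [SimpleGraph.deleteEdges_adj, inn_adj] at hab ⊢
      tauto
    obtain ⟨_, hr2⟩ := reach_induce hxy.2.1 hr'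
    refine hr2.mono ?_
    intro a b hab
    simp only [SimpleGraph.deleteEdges_adj, SimpleGraph.comap_adj] at hab ⊢
    refine ⟨hab.1, fun hh => hab.2 ?_⟩
    simp only [Set.mem_singleton_iff, Sym2.eq_iff] at hh ⊢
    rcases hh with ⟨rfl, rfl⟩ | ⟨rfl, rfl⟩ <;> simp
  · intro h
    let f : H.induce B →g inn H B := ⟨Subtype.val, fun {a b} hab => inn_adj.2 ⟨hab, a.2, b.2⟩⟩
    exact h.comap f Subtype.val_injective

end graphs

section apexgraph
variable {V : Type}

/-- `G` plus an apex vertex adjacent to all of `T`. -/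
def apex (G : SimpleGraph V) (T : Set V) : SimpleGraph (Option V) where
  Adj x y := match x, y with
    | some a, some b => G.Adj a b
    | none, some b => b ∈ T
    | some a, none => a ∈ T
    | none, none => False
  symm := ⟨fun x y h => by
    cases x <;> cases y <;> first | exact h | exact G.symm h | exact h.symm⟩
  loopless := ⟨fun x h => by
    cases x
    · exact h
    · exact G.loopless.irrefl _ h⟩

@[simp] theorem apex_ss {G : SimpleGraph V} {T : Set V} {a b : V} :
    (apex G T).Adj (some a) (some b) ↔ G.Adj a b := Iff.rfl
@[simp] theorem apex_ns {G : SimpleGraph V} {T : Set V} {b : V} :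
    (apex G T).Adj none (some b) ↔ b ∈ T := Iff.rfl
@[simp] theorem apex_sn {G : SimpleGraph V} {T : Set V} {b : V} :
    (apex G T).Adj (some b) none ↔ b ∈ T := Iff.rfl
@[simp] theorem apex_nn {G : SimpleGraph V} {T : Set V} :
    (apex G T).Adj none none ↔ False := Iff.rfl

/-- `X` is a feedback vertex set leaving `T` separated. -/
def Sep (G : SimpleGraph V) (T X : Set V) : Prop := (inn (apex G T) (some '' X)ᶜ).IsAcyclic

theorem isFVS_iff {G : SimpleGraph V} {X : Set V} : IsFVS G X ↔ (inn G Xᶜ).IsAcyclic :=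
  induce_acyclic_iff

theorem Sep.mono {G : SimpleGraph V} {T T' X : Set V} (h : Sep G T X) (hT : T' ⊆ T) :
    Sep G T' X := by
  refine SimpleGraph.IsAcyclic.anti (inn_mono ?_ subset_rfl) h
  intro x y hxy
  cases x <;> cases y <;> simp at hxy ⊢
  · exact hT hxy
  · exact hT hxy
  · exact hxy

theorem sepOn_iff {G : SimpleGraph V} {B T : Set V} : SepOn (inn G B) T ↔ SeparatedIn G B T := by
  constructor
  · intro h a b ha hb haT hbT hr
    exact h a b haT hbT (induce_reach hr)
  · intro h a b haT hbT hr
    by_contra hne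
    obtain ⟨c, hc⟩ := exists_adj_of_reachable hr hne
    obtain ⟨hb, hr'⟩ := reach_induce hc.2.1 hr
    exact hne (h a b hc.2.1 hb haT hbT hr')

theorem sep_iff {G : SimpleGraph V} {T X : Set V} :
    Sep G T X ↔ IsFVS G X ∧ SepOn (inn G Xᶜ) T := by
  rw [isFVS_iff]
  constructor
  · intro h
    refine ⟨?_, ?_⟩
    · let f : inn G Xᶜ →g inn (apex G T) (some '' X)ᶜ := ⟨some, fun {a b} hab =>
        inn_adj.2 ⟨hab.1, by simpa using hab.2.1, by simpa using hab.2.2⟩⟩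
      exact SimpleGraph.IsAcyclic.comap f (Option.some_injective V) h
    · intro a b ha hb hr
      by_contra hne
      have haX : a ∉ X := by
        obtain ⟨c, hc⟩ := exists_adj_of_reachable hr hne
        exact hc.2.1
      have hbX : b ∉ X := by
        obtain ⟨c, hc⟩ := exists_adj_of_reachable hr.symm (Ne.symm hne)
        exact hc.2.1
      apply hne
      have h1 : (inn (inn (apex G T) (some '' X)ᶜ) {none}ᶜ).Reachable (some a) (some b) := by
        refine reach_ind (P := fun b => (inn (inn (apex G T) (some '' X)ᶜ) {none}ᶜ).Reachable
          (some a) (some b)) hr (SimpleGraph.Reachable.refl _) ?_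
        intro x y hx hxy
        refine hx.trans (SimpleGraph.Adj.reachable ?_)
        refine ⟨⟨hxy.1, ?_, ?_⟩, by simp, by simp⟩
        · simpa using hxy.2.1
        · simpa using hxy.2.2
      have h2 : (touch (inn (apex G T) (some '' X)ᶜ) {none}).Reachable (some a) (some b) := by
        have e1 : (touch (inn (apex G T) (some '' X)ᶜ) {none}).Adj (some a) none :=
          ⟨⟨ha, by simpa using haX, by simp⟩, by simp⟩
        have e2 : (touch (inn (apex G T) (some '' X)ᶜ) {none}).Adj none (some b) :=
          ⟨⟨hb, by simp, by simpa using hbX⟩, by simp⟩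
        exact e1.reachable.trans e2.reachable
      have := edge_disjoint_conn h inn_le touch_le (fun x y h h' => by
        rcases h'.2 with h3 | h3
        · exact h.2.1 h3
        · exact h.2.2 h3) h1 h2
      exact Option.some_injective _ this
  · rintro ⟨h1, h2⟩
    set F := inn (apex G T) (some '' X)ᶜ with hF
    have a0 : (touch F {none}).IsAcyclic := by
      refine SimpleGraph.IsAcyclic.anti ?_ (SimpleGraph.isAcyclic_starGraph (none : Option V))
      intro x y hxy
      rw [SimpleGraph.starGraph_adj]
      refine ⟨hxy.ne, ?_⟩
      rcases hxy.2 with h | h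
      · left; simpa using h
      · right; simpa using h
    have a1 : (inn F {none}ᶜ).IsAcyclic := by
      have : (inn F {none}ᶜ).IsAcyclic := by
        rw [← induce_acyclic_iff]
        let g : ({none}ᶜ : Set (Option V)) → V := fun x => x.1.get (by
          rcases x with ⟨x, hx⟩
          cases x
          · simp at hx
          · rfl)
        have hg : ∀ x, some (g x) = x.1 := fun x => by simp [g]
        let f : F.induce {none}ᶜ →g inn G Xᶜ := ⟨g, fun {a b} hab => by
          have hab' : F.Adj a.1 b.1 := hab
          rw [← hg a, ← hg b] at hab'
          obtain ⟨h3, h4, h5⟩ := hab'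
          exact ⟨h3, by simpa using h4, by simpa using h5⟩⟩
        refine SimpleGraph.IsAcyclic.comap f ?_ h1
        intro a b hab
        apply Subtype.ext
        rw [← hg a, ← hg b]
        exact congrArg some hab
      exact this
    refine SimpleGraph.IsAcyclic.anti ?_ (glue (U := {none} ∪ some '' T) a0 a1 ?_ ?_)
    · intro x y hxy
      by_cases h : x = none ∨ y = none
      · exact Or.inl ⟨hxy, h⟩
      · push Not at h
        exact Or.inr ⟨hxy, h.1, h.2⟩
    · intro x y hxy
      have := hxy.1.1
      have := hxy.2
      cases x <;> cases y <;> simp_all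
    · intro x y hx hy hr
      by_contra hne
      obtain ⟨c, hc⟩ := exists_adj_of_reachable hr hne
      obtain ⟨d, hd⟩ := exists_adj_of_reachable hr.symm (Ne.symm hne)
      have hx0 := hc.2.1
      have hy0 := hd.2.1
      cases x with
      | none => simp at hx0
      | some a =>
        cases y with
        | none => simp at hy0
        | some b =>
          have haT : a ∈ T := by simpa using hx
          have hbT : b ∈ T := by simpa using hy
          have : ∃ b', some b = some b' ∧ (inn G Xᶜ).Reachable a b' := by
            refine reach_ind (P := fun z => ∃ b', z = some b' ∧ (inn G Xᶜ).Reachable a b') hr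
              ⟨a, rfl, SimpleGraph.Reachable.refl _⟩ ?_
            rintro u v ⟨b', rfl, hb'⟩ huv
            cases v with
            | none => exact absurd rfl huv.2.2
            | some w =>
              refine ⟨w, rfl, hb'.trans (SimpleGraph.Adj.reachable ?_)⟩
              obtain ⟨h3, h4, h5⟩ := huv.1
              exact ⟨h3, by simpa using h4, by simpa using h5⟩
          obtain ⟨b', hb, hr'⟩ := this
          obtain rfl := Option.some_injective _ hb
          exact hne (congrArg some (h2 _ _ haT hbT hr'))

theorem not_badFor_iff {G : SimpleGraph V} {S T X : Set V} (hX : IsFVS G X) :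
    ¬ BadFor G S T X ↔ S ⊆ X ∧ Sep G T X := by
  unfold BadFor
  rw [sep_iff, sepOn_iff]
  tauto

/-- Neighbours of `D` lie in `D` or in `R`. -/
def Nb (G : SimpleGraph V) (D R : Set V) : Prop := ∀ a ∈ D, ∀ b, G.Adj a b → b ∈ D ∨ b ∈ R

/-- The part of the graph touching `D`. -/
def part (G : SimpleGraph V) (T D X : Set V) : SimpleGraph (Option V) :=
  touch (inn (apex G T) (some '' X)ᶜ) (some '' D)

theorem part_le {G : SimpleGraph V} {T T' D X X' R : Set V} (hN : Nb G D R)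
    (hX : X' ∩ (D ∪ R) ⊆ X) (hT : T ∩ D ⊆ T') : part G T D X ≤ part G T' D X' := by
  intro x y hxy
  obtain ⟨⟨h1, h2, h3⟩, h4⟩ := hxy
  refine ⟨⟨?_, ?_, ?_⟩, h4⟩
  · cases x <;> cases y <;> simp_all
    · exact hT ⟨h1, h4⟩
    · exact hT ⟨h1, h4⟩
  · cases x <;> cases y <;> simp_all
    · intro h5; exact h2 (hX ⟨h5, Or.inl h4⟩)
    · intro h5
      rcases h4 with h4 | h4
      · exact h2 (hX ⟨h5, Or.inl h4⟩)
      · exact h2 (hX ⟨h5, hN _ h4 _ h1.symm⟩)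
  · cases x <;> cases y <;> simp_all
    · intro h5; exact h3 (hX ⟨h5, Or.inl h4⟩)
    · intro h5
      rcases h4 with h4 | h4
      · exact h3 (hX ⟨h5, hN _ h4 _ h1⟩)
      · exact h3 (hX ⟨h5, Or.inl h4⟩)

/-- The part at `D` is a forest which does not connect different outside vertices. -/
def Triv (G : SimpleGraph V) (T D X : Set V) : Prop :=
  (part G T D X).IsAcyclic ∧ SepOn (part G T D X) (some '' D)ᶜ

theorem Triv.anti {G : SimpleGraph V} {T T' D X X' R : Set V} (hN : Nb G D R)
    (hX : X' ∩ (D ∪ R) ⊆ X) (hT : T ∩ D ⊆ T') (h : Triv G T' D X') : Triv G T D X :=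
  ⟨h.1.anti (part_le hN hX hT), fun a b ha hb hr => h.2 a b ha hb (hr.mono (part_le hN hX hT))⟩

theorem replace_sep {G : SimpleGraph V} {T T0 D R X Y : Set V} (hN : Nb G D R)
    (hRD : Disjoint R D) (hY : Y ⊆ D) (hT0 : Disjoint T0 D) (hX : Sep G T0 X)
    (ht : Triv G T D ((X ∩ R) ∪ Y)) : Sep G (T0 ∪ (T ∩ D)) (X \ D ∪ Y) := by
  have ht' : Triv G (T0 ∪ (T ∩ D)) D (X \ D ∪ Y) := by
    refine ht.anti hN ?_ ?_
    · rintro x ⟨hx | hx, hx2⟩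
      · have := Set.disjoint_left.1 hRD hx.2
        exact Or.inl ⟨hx.1, this⟩
      · exact Or.inr hx
    · rintro x ⟨hx | hx, hx2⟩
      · exact absurd hx2 (Set.disjoint_left.1 hT0 hx)
      · exact hx.1
  refine split_acyclic (D := some '' D) ?_ ht'.1 ht'.2
  refine SimpleGraph.IsAcyclic.anti ?_ hX
  intro x y hxy
  obtain ⟨⟨h1, h2, h3⟩, h4, h5⟩ := hxy
  refine ⟨?_, ?_, ?_⟩
  · cases x <;> cases y <;> simp_all
  · cases x <;> simp_all
  · cases y <;> simp_all

theorem replace_fvs {G : SimpleGraph V} {D R X Y : Set V} (hN : Nb G D R)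
    (hR : R ⊆ X) (hX : IsFVS G X) (ha : (inn G (D \ Y)).IsAcyclic) : IsFVS G (X \ D ∪ Y) := by
  rw [isFVS_iff] at hX ⊢
  have hle : touch (inn G (X \ D ∪ Y)ᶜ) D ≤ inn G (D \ Y) := by
    intro x y hxy
    obtain ⟨⟨h1, h2, h3⟩, h4⟩ := hxy
    simp only [Set.mem_compl_iff, Set.mem_union, Set.mem_sdiff, not_or, not_and, not_not] at h2 h3
    refine ⟨h1, ?_⟩
    have hx : x ∈ D := by
      rcases h4 with h | h
      · exact h
      · rcases hN _ h _ h1.symm with h | h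
        · exact h
        · exact h2.1 (hR h)
    have hy : y ∈ D := by
      rcases hN _ hx _ h1 with h | h
      · exact h
      · exact h3.1 (hR h)
    exact ⟨⟨hx, h2.2⟩, ⟨hy, h3.2⟩⟩
  refine split_acyclic (D := D) ?_ (ha.anti hle) ?_
  · refine hX.anti ?_
    intro x y hxy
    obtain ⟨⟨h1, h2, h3⟩, h4, h5⟩ := hxy
    refine ⟨h1, ?_, ?_⟩
    · intro h; exact h2 (Or.inl ⟨h, h4⟩)
    · intro h; exact h3 (Or.inl ⟨h, h5⟩)
  · intro a b haD hbD hr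
    by_contra hne
    obtain ⟨c, hc⟩ := exists_adj_of_reachable hr hne
    exact haD (hle hc).2.1.1

theorem fvs_mono {G : SimpleGraph V} {X Y : Set V} (hX : IsFVS G X) (h : X ⊆ Y) : IsFVS G Y := by
  rw [isFVS_iff] at hX ⊢
  exact hX.anti (inn_mono le_rfl (Set.compl_subset_compl.2 h))

end apexgraph

section exchange
variable {V : Type}

/-- The exchange property. -/
def Exch (G : SimpleGraph V) (R Z C S T S' T' : Set V) : Prop :=
  S' ⊆ S ∩ C ∧ T' ⊆ T ∩ C ∧ ∀ X, IsMinFVS G X → X ∩ R = Z → ∀ T0, Disjoint T0 C → S' ⊆ X →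
    Sep G (T0 ∪ T') X → ∃ X', IsMinFVS G X' ∧ X' \ C = X \ C ∧ S ∩ C ⊆ X' ∧
      Sep G (T0 ∪ (T ∩ C)) X'

theorem exch_self {G : SimpleGraph V} {R Z C S T : Set V} :
    Exch G R Z C S T (S ∩ C) (T ∩ C) :=
  ⟨subset_rfl, subset_rfl, fun X hX _ _ _ hS hT => ⟨X, hX, rfl, hS, hT⟩⟩

theorem Exch.restrict {G : SimpleGraph V} {R Z C S T S' T' : Set V}
    (h : Exch G ∅ ∅ C S T S' T') : Exch G R Z C S T S' T' :=
  ⟨h.1, h.2.1, fun X hX _ => h.2.2 X hX (by simp)⟩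

theorem exch_global {G : SimpleGraph V} {R C S T S' T' : Set V}
    (h : ∀ Z, Z ⊆ R → Exch G R Z C S T S' T') : Exch G ∅ ∅ C S T S' T' :=
  ⟨(h ∅ (Set.empty_subset _)).1, (h ∅ (Set.empty_subset _)).2.1,
    fun X hX _ => (h (X ∩ R) Set.inter_subset_right).2.2 X hX rfl⟩

theorem inter_eq_of_diff_eq {X X' C R : Set V} (h : X' \ C = X \ C) (hR : Disjoint R C) :
    X' ∩ R = X ∩ R := by
  ext x
  have := Set.ext_iff.1 h x
  have h2 : x ∈ R → x ∉ C := fun h => Set.disjoint_left.1 hR h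
  simp only [Set.mem_sdiff, Set.mem_inter_iff] at *
  tauto

theorem exch_union {G : SimpleGraph V} {R Z C1 C2 S T S1 T1 S2 T2 : Set V}
    (hd : Disjoint C1 C2) (hR1 : Disjoint R C1)
    (h1 : Exch G R Z C1 S T S1 T1) (h2 : Exch G R Z C2 S T S2 T2) :
    Exch G R Z (C1 ∪ C2) S T (S1 ∪ S2) (T1 ∪ T2) := by
  have hd' : ∀ x, x ∈ C1 → x ∉ C2 := fun x h => Set.disjoint_left.1 hd h
  refine ⟨?_, ?_, ?_⟩
  · rintro x (hx | hx)
    · exact ⟨(h1.1 hx).1, Or.inl (h1.1 hx).2⟩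
    · exact ⟨(h2.1 hx).1, Or.inr (h2.1 hx).2⟩
  · rintro x (hx | hx)
    · exact ⟨(h1.2.1 hx).1, Or.inl (h1.2.1 hx).2⟩
    · exact ⟨(h2.2.1 hx).1, Or.inr (h2.2.1 hx).2⟩
  · intro X hX hZ T0 hT0 hS hT
    have hT0' : ∀ x, x ∈ T0 → x ∉ C1 ∧ x ∉ C2 := fun x h => by
      have := Set.disjoint_left.1 hT0 h
      simpa using this
    obtain ⟨X1, hX1, e1, s1, t1⟩ := h1.2.2 X hX hZ (T0 ∪ T2) (by
      rw [Set.disjoint_left]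
      rintro x (hx | hx) hx1
      · exact (hT0' x hx).1 hx1
      · exact hd' x hx1 (h2.2.1 hx).2) (Set.subset_union_left.trans hS) (hT.mono (by
        rintro x ((hx | hx) | hx) <;> simp [hx]))
    have e1' := Set.ext_iff.1 e1
    obtain ⟨X2, hX2, e2, s2, t2⟩ := h2.2.2 X1 hX1 ((inter_eq_of_diff_eq e1 hR1).trans hZ)
      (T0 ∪ (T ∩ C1)) (by
        rw [Set.disjoint_left]
        rintro x (hx | hx) hx1
        · exact (hT0' x hx).2 hx1
        · exact hd' x hx.2 hx1) (by
        intro x hx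
        have h3 : x ∈ X := hS (Or.inr hx)
        have h4 : x ∉ C1 := fun h => hd' x h (h2.1 hx).2
        exact ((e1' x).2 ⟨h3, h4⟩).1) (t1.mono (by
        rintro x ((hx | hx) | hx)
        · exact Or.inl (Or.inl hx)
        · exact Or.inr hx
        · exact Or.inl (Or.inr hx)))
    have e2' := Set.ext_iff.1 e2
    refine ⟨X2, hX2, ?_, ?_, t2.mono ?_⟩
    · ext x
      have a := e1' x
      have b := e2' x
      simp only [Set.mem_sdiff, Set.mem_union] at *
      tauto
    · rintro x ⟨hx, hx1 | hx2⟩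
      · exact ((e2' x).2 ⟨s1 ⟨hx, hx1⟩, hd' x hx1⟩).1
      · exact s2 ⟨hx, hx2⟩
    · rintro x (hx | ⟨hx, hx1 | hx2⟩)
      · exact Or.inl (Or.inl hx)
      · exact Or.inl (Or.inr ⟨hx, hx1⟩)
      · exact Or.inr ⟨hx, hx2⟩

theorem exch_loop {ι : Type} {G : SimpleGraph V} {R Z S T : Set V} {D s t : ι → Set V}
    (hd : ∀ i j, i ≠ j → Disjoint (D i) (D j)) (hR : ∀ i, Disjoint R (D i)) (J : Finset ι)
    (h : ∀ i ∈ J, Exch G R Z (D i) S T (s i) (t i)) :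
    Exch G R Z (⋃ i ∈ J, D i) S T (⋃ i ∈ J, s i) (⋃ i ∈ J, t i) := by
  classical
  induction J using Finset.induction_on with
  | empty =>
    have := exch_self (G := G) (R := R) (Z := Z) (C := ∅) (S := S) (T := T)
    simpa using this
  | insert i J hi ih =>
    simp only [Finset.set_biUnion_insert]
    refine exch_union ?_ (hR i) (h i (Finset.mem_insert_self _ _))
      (ih fun j hj => h j (Finset.mem_insert_of_mem hj))
    simp only [Set.disjoint_iUnion_right]
    intro j hj
    exact hd i j (fun e => hi (e ▸ hj))

/-- `D` can be solved optimally and trivially if `Z` is deleted from the boundary. -/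
def Good (G : SimpleGraph V) (S T D Z : Set V) : Prop :=
  ∃ Y, Y ⊆ D ∧ S ∩ D ⊆ Y ∧ (∀ Y', Y' ⊆ D → (inn G (D \ Y')).IsAcyclic → Y.ncard ≤ Y'.ncard) ∧
    Triv G T D (Z ∪ Y)

theorem ncard_split [Finite V] (X D : Set V) : X.ncard = (X ∩ D).ncard + (X \ D).ncard := by
  rw [Set.ncard_inter_add_ncard_sdiff_eq_ncard]

theorem fvs_local {G : SimpleGraph V} {X D : Set V} (h : IsFVS G X) :
    (inn G (D \ (X ∩ D))).IsAcyclic := by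
  rw [isFVS_iff] at h
  refine h.anti (inn_mono le_rfl ?_)
  rintro x ⟨hx, hx2⟩ hx3
  exact hx2 ⟨hx3, hx⟩

theorem exch_good [Finite V] {G : SimpleGraph V} {R Z S T D : Set V} (hN : Nb G D R)
    (hRD : Disjoint R D) (hg : Good G S T D Z) : Exch G R Z D S T ∅ ∅ := by
  obtain ⟨Y, hY, hSY, hmin, ht⟩ := hg
  refine ⟨Set.empty_subset _, Set.empty_subset _, ?_⟩
  rintro X hX rfl T0 hT0 - hT
  have hs := replace_sep hN hRD hY hT0 (hT.mono Set.subset_union_left) ht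
  refine ⟨X \ D ∪ Y, ⟨(sep_iff.1 hs).1, ?_⟩, ?_, ?_, hs⟩
  · intro W hW
    have h1 := hX.2 W hW
    have h2 := hmin (X ∩ D) Set.inter_subset_right (fvs_local hX.1)
    have h3 := ncard_split X D
    have h4 := Set.ncard_union_le (X \ D) Y
    omega
  · ext x
    have := @hY x
    simp only [Set.mem_sdiff, Set.mem_union]
    tauto
  · exact hSY.trans Set.subset_union_right

theorem excess_bound [Finite V] {ι : Type} {G : SimpleGraph V} {R X : Set V} {D : ι → Set V}
    (hd : ∀ i j, i ≠ j → Disjoint (D i) (D j)) (hR : ∀ i, Disjoint R (D i))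
    (hN : ∀ i, Nb G (D i) R) (hX : IsMinFVS G X) (J : Finset ι)
    (h : ∀ i ∈ J, ∃ Y, Y ⊆ D i ∧ (inn G (D i \ Y)).IsAcyclic ∧ Y.ncard < (X ∩ D i).ncard) :
    J.card ≤ R.ncard := by
  classical
  have key : ∃ XJ, IsFVS G XJ ∧ R ⊆ XJ ∧ (∀ i, i ∉ J → XJ ∩ D i = X ∩ D i) ∧
      XJ.ncard + J.card ≤ X.ncard + R.ncard := by
    induction J using Finset.induction_on with
    | empty =>
      refine ⟨X ∪ R, fvs_mono hX.1 Set.subset_union_left, Set.subset_union_right, ?_, ?_⟩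
      · intro i _
        ext x
        have : x ∈ R → x ∉ D i := fun h => Set.disjoint_left.1 (hR i) h
        simp only [Set.mem_inter_iff, Set.mem_union]
        tauto
      · simpa using Set.ncard_union_le X R
    | insert i J hi ih =>
      obtain ⟨XJ, f, hRX, e, c⟩ := ih fun j hj => h j (Finset.mem_insert_of_mem hj)
      obtain ⟨Y, hY, ha, hc⟩ := h i (Finset.mem_insert_self _ _)
      refine ⟨XJ \ D i ∪ Y, replace_fvs (hN i) hRX f ha, ?_, ?_, ?_⟩
      · intro x hx
        exact Or.inl ⟨hRX hx, Set.disjoint_left.1 (hR i) hx⟩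
      · intro j hj
        rw [Finset.mem_insert, not_or] at hj
        rw [← e j hj.2]
        ext x
        have h1 : x ∈ D i → x ∉ D j := fun h => Set.disjoint_left.1 (hd i j (Ne.symm hj.1)) h
        have h2 := @hY x
        simp only [Set.mem_inter_iff, Set.mem_union, Set.mem_sdiff]
        tauto
      · rw [Finset.card_insert_of_notMem hi]
        have h3 := ncard_split XJ (D i)
        have h4 := Set.ncard_union_le (XJ \ D i) Y
        rw [e i hi] at h3
        omega
  obtain ⟨XJ, f, -, -, c⟩ := key
  have := hX.2 XJ f
  omega

theorem nontriv_bound [Finite V] {ι : Type} {G : SimpleGraph V} {R X T : Set V} {D : ι → Set V}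
    (hd : ∀ i j, i ≠ j → Disjoint (D i) (D j)) (hR : ∀ i, Disjoint R (D i))
    (hN : ∀ i, Nb G (D i) R) (hX : Sep G T X) (J : Finset ι)
    (h : ∀ i ∈ J, ¬ Triv G T (D i) X) :
    J.card ≤ (R.ncard + 1) ^ 2 := by
  classical
  have h1 : ∀ i, ∃ p : Option V × Option V, i ∈ J → p.1 ∉ some '' (D i) ∧ p.2 ∉ some '' (D i) ∧
      p.1 ≠ p.2 ∧ (part G T (D i) X).Reachable p.1 p.2 := by
    intro i
    by_cases hi : i ∈ J
    · have := h i hi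
      unfold Triv at this
      have hac : (part G T (D i) X).IsAcyclic := SimpleGraph.IsAcyclic.anti touch_le hX
      simp only [hac, true_and, SepOn] at this
      push Not at this
      obtain ⟨a, b, ha, hb, hr, hne⟩ := this
      exact ⟨(a, b), fun _ => ⟨ha, hb, hne, hr⟩⟩
    · exact ⟨(none, none), fun h => absurd h hi⟩
  choose p hp using h1
  have hmem : ∀ i x c, x ∉ some '' (D i) → (part G T (D i) X).Adj x c →
      x ∈ insert none (some '' R) := by
    intro i x c hx hc
    obtain ⟨⟨h2, -, -⟩, h3⟩ := hc
    have hc' := h3.resolve_left hx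
    obtain ⟨d, hd, rfl⟩ := hc'
    cases x with
    | none => simp
    | some x =>
      rcases hN i d hd x (apex_ss.1 h2).symm with h4 | h4
      · exact absurd ⟨x, h4, rfl⟩ hx
      · exact Or.inr ⟨x, h4, rfl⟩
  set Q : Set (Option V) := insert none (some '' R) with hQ
  have hQc : Q.ncard ≤ R.ncard + 1 := by
    refine (Set.ncard_insert_le _ _).trans ?_
    have := Set.ncard_image_le (f := (some : V → Option V)) (Set.toFinite R)
    omega
  by_contra hlt
  push Not at hlt
  have hfin : (Q ×ˢ Q).Finite := Set.toFinite _
  have hcard : hfin.toFinset.card < J.card := by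
    rw [← Set.ncard_eq_toFinset_card _ hfin, Set.ncard_prod]
    calc Q.ncard * Q.ncard ≤ (R.ncard + 1) * (R.ncard + 1) := Nat.mul_le_mul hQc hQc
      _ = (R.ncard + 1) ^ 2 := by ring
      _ < _ := hlt
  obtain ⟨i, hi, j, hj, hij, he⟩ := Finset.exists_ne_map_eq_of_card_lt_of_maps_to hcard
    (f := p) (by
      intro i hi
      obtain ⟨h2, h3, h4, h5⟩ := hp i hi
      obtain ⟨c, hc⟩ := exists_adj_of_reachable h5 h4
      obtain ⟨c', hc'⟩ := exists_adj_of_reachable h5.symm (Ne.symm h4)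
      simp only [Set.Finite.coe_toFinset, Set.mem_prod]
      exact ⟨hmem i _ _ h2 hc, hmem i _ _ h3 hc'⟩)
  obtain ⟨-, -, h4, h5⟩ := hp i hi
  obtain ⟨-, -, -, h6⟩ := hp j hj
  rw [← he] at h6
  refine h4 (edge_disjoint_conn hX touch_le touch_le ?_ h5 h6)
  have aux : ∀ (i j : ι), i ≠ j → ∀ x y, (apex G T).Adj x y → x ∈ some '' D i →
      (x ∈ some '' D j ∨ y ∈ some '' D j) → False := by
    rintro i j hij x y hxy ⟨x, hx, rfl⟩ (⟨x', hx', e⟩ | ⟨y, hy, rfl⟩)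
    · obtain rfl := Option.some_injective _ e
      exact Set.disjoint_left.1 (hd i j hij) hx hx'
    · rcases hN i x hx y hxy with h | h
      · exact Set.disjoint_left.1 (hd i j hij) h hy
      · exact Set.disjoint_left.1 (hR j) h hy
  intro x y hx hy
  rcases hx.2 with h | h
  · exact aux i j hij x y hx.1.1 h hy.2
  · exact aux i j hij y x hx.1.1.symm h hy.2.symm

theorem ncard_biUnion_le {ι : Type} (J : Finset ι) (s : ι → Set V) (n : ℕ)
    (h : ∀ i, (s i).ncard ≤ n) : (⋃ i ∈ J, s i).ncard ≤ J.card * n := by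
  classical
  induction J using Finset.induction_on with
  | empty => simp
  | insert i J hi ih =>
    rw [Finset.set_biUnion_insert, Finset.card_insert_of_notMem hi]
    have h1 := Set.ncard_union_le (s i) (⋃ i ∈ J, s i)
    have h2 := h i
    rw [Nat.add_mul]
    omega

/-- Bound for unions. -/
def NN (r n : ℕ) : ℕ := 2 ^ r * (r + (r + 1) ^ 2 + 1) * n

theorem sel_union [Finite V] {ι : Type} [Fintype ι] {G : SimpleGraph V} {R S T : Set V}
    {D : ι → Set V} {r n : ℕ}
    (hd : ∀ i j, i ≠ j → Disjoint (D i) (D j)) (hR : ∀ i, Disjoint R (D i))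
    (hN : ∀ i, Nb G (D i) R) (hr : R.ncard ≤ r)
    (h : ∀ i, ∃ S' T' : Set V, S'.ncard ≤ n ∧ T'.ncard ≤ n ∧ Exch G ∅ ∅ (D i) S T S' T') :
    ∃ S' T' : Set V, S'.ncard ≤ NN r n ∧ T'.ncard ≤ NN r n ∧
      Exch G ∅ ∅ (⋃ i, D i) S T S' T' := by
  classical
  choose s t hs ht he using h
  set N := r + (r + 1) ^ 2 with hNdef
  have hK : ∀ Z : Set V, ∃ K : Finset ι, K ⊆ Finset.univ.filter (fun i => ¬ Good G S T (D i) Z) ∧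
      K.card ≤ N + 1 ∧
      (K.card = N + 1 ∨ K = Finset.univ.filter (fun i => ¬ Good G S T (D i) Z)) := by
    intro Z
    by_cases hc : N + 1 ≤ (Finset.univ.filter (fun i => ¬ Good G S T (D i) Z)).card
    · obtain ⟨K, hK1, hK2⟩ := Finset.exists_subset_card_eq hc
      exact ⟨K, hK1, hK2.le, Or.inl hK2⟩
    · exact ⟨_, subset_rfl, by omega, Or.inr rfl⟩
  choose K hK1 hK2 hK3 using hK
  have hRf : R.Finite := Set.toFinite R
  set keep : Finset ι := hRf.toFinset.powerset.biUnion (fun Z => K (Z : Set V)) with hkeep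
  have hcard : keep.card ≤ 2 ^ r * (N + 1) := by
    refine (Finset.card_biUnion_le_card_mul _ _ (N + 1) (fun Z _ => hK2 _)).trans ?_
    rw [Finset.card_powerset, ← Set.ncard_eq_toFinset_card _ hRf]
    exact Nat.mul_le_mul_right _ (Nat.pow_le_pow_right (by norm_num) hr)
  have hsub : ∀ Z, Z ⊆ R → K Z ⊆ keep := by
    intro Z hZ i hi
    rw [hkeep, Finset.mem_biUnion]
    refine ⟨(Set.toFinite Z).toFinset, ?_, ?_⟩
    · rw [Finset.mem_powerset]
      intro x hx
      simp only [Set.Finite.mem_toFinset] at hx ⊢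
      exact hZ hx
    · simpa using hi
  refine ⟨⋃ i ∈ keep, s i, ⋃ i ∈ keep, t i,
    (ncard_biUnion_le keep s n hs).trans (Nat.mul_le_mul_right _ hcard),
    (ncard_biUnion_le keep t n ht).trans (Nat.mul_le_mul_right _ hcard), ?_⟩
  apply exch_global (R := R)
  intro Z hZ
  rcases hK3 Z with hc | hc
  · have hl := exch_loop (Z := Z) hd hR (K Z) (fun i _ => (he i).restrict)
    have hl' := exch_loop (Z := Z) hd hR keep (fun i _ => (he i).restrict)
    have hsubU : (⋃ i ∈ keep, D i) ⊆ ⋃ i, D i := by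
      intro x hx
      simp only [Set.mem_iUnion] at hx ⊢
      obtain ⟨i, -, hi⟩ := hx
      exact ⟨i, hi⟩
    refine ⟨hl'.1.trans (Set.inter_subset_inter_right _ hsubU),
      hl'.2.1.trans (Set.inter_subset_inter_right _ hsubU), ?_⟩
    intro X hX hXZ T0 hT0 hSX hTX
    exfalso
    have hmono : ∀ f : ι → Set V, (⋃ i ∈ K Z, f i) ⊆ ⋃ i ∈ keep, f i := fun f =>
      Set.biUnion_mono (fun i hi => hsub Z hZ hi) (fun _ _ => subset_rfl)
    obtain ⟨X', hX', e, hS', hT'⟩ := hl.2.2 X hX hXZ T0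
      (hT0.mono_right ((hmono D).trans hsubU)) ((hmono s).trans hSX)
      (hTX.mono (Set.union_subset_union_right _ (hmono t)))
    have hXZ' : X' ∩ R = Z := by
      rw [← hXZ]
      refine inter_eq_of_diff_eq e ?_
      simp only [Set.disjoint_iUnion_right]
      exact fun i _ => hR i
    set tight : ι → Prop := fun i => ∃ Y, Y ⊆ D i ∧ (inn G (D i \ Y)).IsAcyclic ∧
      Y.ncard < (X' ∩ D i).ncard with htight
    have b1 := excess_bound hd hR hN hX' ((K Z).filter tight) (fun i hi =>
      (Finset.mem_filter.1 hi).2)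
    have b2 := nontriv_bound hd hR hN hT' ((K Z).filter (fun i => ¬ tight i)) (by
      intro i hi htr
      obtain ⟨hiK, hnt⟩ := Finset.mem_filter.1 hi
      have hbad := (Finset.mem_filter.1 (hK1 Z hiK)).2
      apply hbad
      have hDi : D i ⊆ ⋃ i ∈ K Z, D i := Set.subset_biUnion_of_mem (u := D) hiK
      refine ⟨X' ∩ D i, Set.inter_subset_right, ?_, ?_, ?_⟩
      · rintro x ⟨hx, hx2⟩
        exact ⟨hS' ⟨hx, hDi hx2⟩, hx2⟩
      · intro Y' hY' ha
        by_contra hlt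
        exact hnt ⟨Y', hY', ha, not_le.1 hlt⟩
      · refine htr.anti (hN i) ?_ ?_
        · rintro x ⟨hx, hx2 | hx2⟩
          · exact Or.inr ⟨hx, hx2⟩
          · exact Or.inl (hXZ' ▸ ⟨hx, hx2⟩)
        · rintro x ⟨hx, hx2⟩
          exact Or.inr ⟨hx, hDi hx2⟩)
    have b3 := Finset.card_filter_add_card_filter_not (s := K Z) tight
    have b4 : (R.ncard + 1) ^ 2 ≤ (r + 1) ^ 2 := Nat.pow_le_pow_left (by omega) 2
    omega
  · have hl := exch_loop (Z := Z) hd hR Finset.univ (s := fun i => if i ∈ keep then s i else ∅)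
      (t := fun i => if i ∈ keep then t i else ∅) (S := S) (T := T) (G := G) (by
        intro i _
        by_cases hi : i ∈ keep
        · simp only [hi, if_true]
          exact (he i).restrict
        · simp only [hi, if_false]
          apply exch_good (hN i) (hR i)
          by_contra hb
          exact hi (hsub Z hZ (by rw [hc]; simpa using hb)))
    have e1 : ∀ f : ι → Set V, (⋃ i ∈ (Finset.univ : Finset ι), if i ∈ keep then f i else ∅) =
        ⋃ i ∈ keep, f i := by
      intro f
      ext x
      simp only [Finset.mem_univ, Set.iUnion_true, Set.mem_iUnion]
      constructor
      · rintro ⟨i, hi⟩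
        by_cases hk : i ∈ keep
        · exact ⟨i, hk, by simpa [hk] using hi⟩
        · simp [hk] at hi
      · rintro ⟨i, hk, hi⟩
        exact ⟨i, by simpa [hk] using hi⟩
    rw [e1 s, e1 t] at hl
    simpa using hl

end exchange

section forest
variable {V : Type}

theorem find_sub_aux [Finite V] {G : SimpleGraph V} {A T : Set V} (hA : (inn G A).IsAcyclic)
    (m : ℕ) : ∀ (B : Set V) (u : V), B.ncard = m → B ⊆ A → u ∈ B →
    (∀ x ∈ B, x ≠ u → ∀ y ∈ A, G.Adj x y → y ∈ B) →
    (∃ t1 t2, t1 ∈ T ∧ t2 ∈ T ∧ t1 ∈ B ∧ t2 ∈ B ∧ t1 ≠ t2 ∧ (inn G B).Reachable t1 t2) →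
    ∃ (B : Set V) (u : V), B ⊆ A ∧ u ∈ B ∧ (∀ x ∈ B, x ≠ u → ∀ y ∈ A, G.Adj x y → y ∈ B) ∧
    (∃ t1 t2, t1 ∈ T ∧ t2 ∈ T ∧ t1 ∈ B ∧ t2 ∈ B ∧ t1 ≠ t2 ∧ (inn G B).Reachable t1 t2) ∧
    SepOn (inn G (B \ {u})) T := by
  induction m using Nat.strong_induction_on with
  | _ m ih =>
    intro B u hm hBA huB hcl ht
    by_cases hs : SepOn (inn G (B \ {u})) T
    · exact ⟨B, u, hBA, huB, hcl, ht, hs⟩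
    · unfold SepOn at hs
      push Not at hs
      obtain ⟨t1, t2, ht1, ht2, hr, hne⟩ := hs
      obtain ⟨c, hc⟩ := exists_adj_of_reachable hr hne
      set K : Set V := {x | (inn G (B \ {u})).Reachable t1 x} with hK
      have hKB : K ⊆ B \ {u} := fun x hx => inn_reach_mem hc.2.1 hx
      have hr2 : (inn G K).Reachable t1 t2 := by
        have : (inn G (B \ {u})).Reachable t1 t2 ∧ (inn G K).Reachable t1 t2 := by
          refine reach_ind (P := fun z => (inn G (B \ {u})).Reachable t1 z ∧
            (inn G K).Reachable t1 z) hr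
            ⟨SimpleGraph.Reachable.refl _, SimpleGraph.Reachable.refl _⟩ ?_
          rintro x y ⟨h1, h2⟩ hxy
          have h3 : (inn G (B \ {u})).Reachable t1 y := h1.trans hxy.reachable
          exact ⟨h3, h2.trans (SimpleGraph.Adj.reachable ⟨hxy.1, h1, h3⟩)⟩
        exact this.2
      have huniq : ∀ y ∈ K, ∀ y' ∈ K, G.Adj u y → G.Adj u y' → y = y' := by
        intro y hy y' hy' h1 h2
        have l1 : inn G (B \ {u}) ≤ inn G A :=
          inn_mono le_rfl (Set.sdiff_subset.trans hBA)
        have hyA := hBA (hKB hy).1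
        have hyA' := hBA (hKB hy').1
        have r1 : (touch (inn G A) {u}).Reachable y y' := by
          have e1 : (touch (inn G A) {u}).Adj y u := ⟨⟨h1.symm, hyA, hBA huB⟩, by simp⟩
          have e2 : (touch (inn G A) {u}).Adj u y' := ⟨⟨h2, hBA huB, hyA'⟩, by simp⟩
          exact e1.reachable.trans e2.reachable
        have r2 : (inn G (B \ {u})).Reachable y y' :=
          (show (inn G (B \ {u})).Reachable t1 y from hy).symm.trans hy'
        refine edge_disjoint_conn hA l1 touch_le ?_ r2 r1
        intro a b hab hab'
        rcases hab'.2 with h | h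
        · exact hab.2.1.2 h
        · exact hab.2.2.2 h
      have hu' : ∃ u' ∈ K, ∀ y ∈ K, G.Adj u y → y = u' := by
        by_cases hex : ∃ y ∈ K, G.Adj u y
        · obtain ⟨y, hy, hyu⟩ := hex
          exact ⟨y, hy, fun y' hy' h => huniq y' hy' y hy h hyu⟩
        · push Not at hex
          exact ⟨t1, SimpleGraph.Reachable.refl _, fun y hy h => absurd h (hex y hy)⟩
      obtain ⟨u', hu'K, hu'⟩ := hu'
      have hlt : K.ncard < m := by
        rw [← hm]
        refine Set.ncard_lt_ncard ?_
        refine ⟨fun x hx => (hKB hx).1, fun h => ?_⟩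
        exact (hKB (h huB)).2 rfl
      refine ih _ hlt K u' rfl (fun x hx => hBA (hKB hx).1) hu'K ?_
        ⟨t1, t2, ht1, ht2, SimpleGraph.Reachable.refl _, hr, hne, hr2⟩
      intro x hx hxu y hy hxy
      have hxB := hKB hx
      have hyB := hcl x hxB.1 hxB.2 y hy hxy
      have hyu : y ≠ u := by
        rintro rfl
        exact hxu (hu' x hx hxy.symm)
      exact SimpleGraph.Reachable.trans hx (SimpleGraph.Adj.reachable ⟨hxy, hxB, hyB, hyu⟩)

theorem find_sub [Finite V] {G : SimpleGraph V} {A T : Set V} (hA : (inn G A).IsAcyclic)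
    (h : ¬ SepOn (inn G A) T) :
    ∃ (B : Set V) (u : V), B ⊆ A ∧ u ∈ B ∧ (∀ x ∈ B, x ≠ u → ∀ y ∈ A, G.Adj x y → y ∈ B) ∧
    (∃ t1 t2, t1 ∈ T ∧ t2 ∈ T ∧ t1 ∈ B ∧ t2 ∈ B ∧ t1 ≠ t2 ∧ (inn G B).Reachable t1 t2) ∧
    SepOn (inn G (B \ {u})) T := by
  unfold SepOn at h
  push Not at h
  obtain ⟨t1, t2, ht1, ht2, hr, hne⟩ := h
  obtain ⟨c, hc⟩ := exists_adj_of_reachable hr hne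
  exact find_sub_aux hA _ A t1 rfl subset_rfl hc.2.1 (fun _ _ _ y hy _ => hy)
    ⟨t1, t2, ht1, ht2, hc.2.1, inn_reach_mem hc.2.1 hr, hne, hr⟩

/-- Erdos-Posa property of `T`-paths in forests. -/
theorem forest_ep [Finite V] {G : SimpleGraph V} {T : Set V} (n : ℕ) : ∀ A : Set V,
    (inn G A).IsAcyclic →
    (∃ P, P ⊆ A ∧ P.ncard ≤ n ∧ SepOn (inn G (A \ P)) T) ∨
    (∃ T', T' ⊆ T ∩ A ∧ T'.ncard ≤ 2 * (n + 1) ∧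
      ∀ P : Set V, P.ncard ≤ n → ¬ SepOn (inn G (A \ P)) T') := by
  induction n with
  | zero =>
    intro A hA
    by_cases hs : SepOn (inn G A) T
    · exact Or.inl ⟨∅, Set.empty_subset _, by simp, by simpa using hs⟩
    · right
      obtain ⟨B, u, hBA, -, -, ⟨t1, t2, h1, h2, h1B, h2B, hne, hr⟩, -⟩ := find_sub hA hs
      refine ⟨{t1, t2}, ?_, ?_, ?_⟩
      · rintro x (rfl | rfl)
        · exact ⟨h1, hBA h1B⟩
        · exact ⟨h2, hBA h2B⟩
      · rw [Set.ncard_pair hne]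
      · intro P hP hsep
        have : P = ∅ := by
          rw [← Set.ncard_eq_zero (Set.toFinite P)]; omega
        subst this
        exact hne (hsep t1 t2 (by simp) (by simp) (hr.mono (inn_mono le_rfl (by simpa using hBA))))
  | succ n ih =>
    intro A hA
    by_cases hs : SepOn (inn G A) T
    · exact Or.inl ⟨∅, Set.empty_subset _, by simp, by simpa using hs⟩
    · obtain ⟨B, u, hBA, huB, hcl, ⟨t1, t2, h1, h2, h1B, h2B, hne, hr⟩, hsB⟩ := find_sub hA hs
      rcases ih (A \ B) (hA.anti (inn_mono le_rfl Set.sdiff_subset)) with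
        ⟨P, hPA, hPc, hP⟩ | ⟨T', hT', hTc, hT⟩
      · left
        refine ⟨insert u P, ?_, ?_, ?_⟩
        · rintro x (rfl | hx)
          · exact hBA huB
          · exact (hPA hx).1
        · exact (Set.ncard_insert_le _ _).trans (by omega)
        · intro a b ha hb hab
          by_contra hne'
          obtain ⟨c, hc⟩ := exists_adj_of_reachable hab hne'
          have hu : ∀ x, x ∈ A \ insert u P → x ≠ u := fun x hx e => hx.2 (Or.inl e)
          by_cases haB : a ∈ B
          · have : b ∈ B ∧ (inn G (B \ {u})).Reachable a b := by
              refine reach_ind (P := fun z => z ∈ B ∧ (inn G (B \ {u})).Reachable a z) hab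
                ⟨haB, SimpleGraph.Reachable.refl _⟩ ?_
              rintro x y ⟨hx, hx2⟩ hxy
              have hyB := hcl x hx (hu x hxy.2.1) y hxy.2.2.1 hxy.1
              exact ⟨hyB, hx2.trans (SimpleGraph.Adj.reachable
                ⟨hxy.1, ⟨hx, hu x hxy.2.1⟩, ⟨hyB, hu y hxy.2.2⟩⟩)⟩
            exact hne' (hsB a b ha hb this.2)
          · have : b ∉ B ∧ (inn G ((A \ B) \ P)).Reachable a b := by
              refine reach_ind (P := fun z => z ∉ B ∧ (inn G ((A \ B) \ P)).Reachable a z) hab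
                ⟨haB, SimpleGraph.Reachable.refl _⟩ ?_
              rintro x y ⟨hx, hx2⟩ hxy
              have hyB : y ∉ B := fun h =>
                hx (hcl y h (hu y hxy.2.2) x hxy.2.1.1 hxy.1.symm)
              exact ⟨hyB, hx2.trans (SimpleGraph.Adj.reachable
                ⟨hxy.1, ⟨⟨hxy.2.1.1, hx⟩, fun h => hxy.2.1.2 (Or.inr h)⟩,
                  ⟨⟨hxy.2.2.1, hyB⟩, fun h => hxy.2.2.2 (Or.inr h)⟩⟩)⟩
            exact hne' (hP a b ha hb this.2)
      · right
        refine ⟨T' ∪ {t1, t2}, ?_, ?_, ?_⟩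
        · rintro x (hx | rfl | rfl)
          · exact ⟨(hT' hx).1, (hT' hx).2.1⟩
          · exact ⟨h1, hBA h1B⟩
          · exact ⟨h2, hBA h2B⟩
        · refine (Set.ncard_union_le _ _).trans ?_
          rw [Set.ncard_pair hne]
          omega
        · intro P hP hsep
          have hex : ∃ x ∈ P, x ∈ B := by
            by_contra hno
            push Not at hno
            refine hne (hsep t1 t2 (by simp) (by simp) (hr.mono (inn_mono le_rfl ?_)))
            intro x hx
            exact ⟨hBA hx, fun h => hno x h hx⟩
          obtain ⟨x, hxP, hxB⟩ := hex
          refine hT (P \ B) ?_ ?_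
          · have h3 : (P \ B).ncard < P.ncard := by
              refine Set.ncard_lt_ncard ⟨Set.sdiff_subset, fun h => ?_⟩
              exact (h hxP).2 hxB
            omega
          · intro a b ha hb hab
            refine hsep a b (Or.inl ha) (Or.inl hb) (hab.mono (inn_mono le_rfl ?_))
            rintro y ⟨⟨hy1, hy2⟩, hy3⟩
            exact ⟨hy1, fun h => hy3 ⟨h, hy2⟩⟩

/-- Vertex sets of the components of `G[A]`. -/
def comp (G : SimpleGraph V) (A : Set V) (C : (G.induce A).ConnectedComponent) : Set V :=
  Subtype.val '' C.supp

theorem comp_sub {G : SimpleGraph V} {A : Set V} (C : (G.induce A).ConnectedComponent) :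
    comp G A C ⊆ A := by
  rintro x ⟨y, -, rfl⟩
  exact y.2

theorem mem_comp {G : SimpleGraph V} {A : Set V} {C : (G.induce A).ConnectedComponent} {x : V} :
    x ∈ comp G A C ↔ ∃ h : x ∈ A, (G.induce A).connectedComponentMk ⟨x, h⟩ = C := by
  constructor
  · rintro ⟨y, hy, rfl⟩
    exact ⟨y.2, hy⟩
  · rintro ⟨h, e⟩
    exact ⟨⟨x, h⟩, e, rfl⟩

theorem comp_disjoint {G : SimpleGraph V} {A : Set V} (C C' : (G.induce A).ConnectedComponent)
    (h : C ≠ C') : Disjoint (comp G A C) (comp G A C') := by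
  rw [Set.disjoint_left]
  intro x hx hx'
  obtain ⟨h1, rfl⟩ := mem_comp.1 hx
  obtain ⟨h2, e⟩ := mem_comp.1 hx'
  exact h e

theorem comp_union {G : SimpleGraph V} {A : Set V} : ⋃ C, comp G A C = A := by
  ext x
  simp only [Set.mem_iUnion, mem_comp]
  constructor
  · rintro ⟨_, h, _⟩
    exact h
  · intro h
    exact ⟨_, h, rfl⟩

theorem comp_nb {G : SimpleGraph V} {A R : Set V} (hN : Nb G A R)
    (C : (G.induce A).ConnectedComponent) : Nb G (comp G A C) R := by
  intro a ha b hab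
  obtain ⟨h1, rfl⟩ := mem_comp.1 ha
  rcases hN a h1 b hab with h | h
  · left
    refine mem_comp.2 ⟨h, ?_⟩
    rw [SimpleGraph.ConnectedComponent.eq]
    apply SimpleGraph.Adj.reachable
    exact hab.symm
  · exact Or.inr h

theorem comp_reach {G : SimpleGraph V} {A : Set V} {C : (G.induce A).ConnectedComponent} {x y : V}
    (hx : x ∈ comp G A C) (hy : y ∈ comp G A C) : (inn G A).Reachable x y := by
  obtain ⟨h1, rfl⟩ := mem_comp.1 hx
  obtain ⟨h2, e⟩ := mem_comp.1 hy
  rw [SimpleGraph.ConnectedComponent.eq] at e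
  exact (induce_reach e).symm

theorem sel_comps [Finite V] {G : SimpleGraph V} {A R S T : Set V} {r n : ℕ}
    (hN : Nb G A R) (hRA : Disjoint R A) (hr : R.ncard ≤ r)
    (h : ∀ C, ∃ S' T' : Set V, S'.ncard ≤ n ∧ T'.ncard ≤ n ∧
      Exch G ∅ ∅ (comp G A C) S T S' T') :
    ∃ S' T' : Set V, S'.ncard ≤ NN r n ∧ T'.ncard ≤ NN r n ∧ Exch G ∅ ∅ A S T S' T' := by
  classical
  have : Fintype (G.induce A).ConnectedComponent := Fintype.ofFinite _
  have := sel_union (D := comp G A) comp_disjoint (fun C => hRA.mono_right (comp_sub C))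
    (comp_nb hN) hr h
  rwa [comp_union] at this

/-- Adding a few vertices. -/
theorem sel_add [Finite V] {G : SimpleGraph V} {D P S T : Set V} {n p : ℕ} (hd : Disjoint D P)
    (hp : P.ncard ≤ p)
    (h : ∃ S' T' : Set V, S'.ncard ≤ n ∧ T'.ncard ≤ n ∧ Exch G ∅ ∅ D S T S' T') :
    ∃ S' T' : Set V, S'.ncard ≤ n + p ∧ T'.ncard ≤ n + p ∧ Exch G ∅ ∅ (D ∪ P) S T S' T' := by
  obtain ⟨S', T', h1, h2, h3⟩ := h
  have b : ∀ U : Set V, (U ∩ P).ncard ≤ p := fun U =>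
    (Set.ncard_le_ncard Set.inter_subset_right (Set.toFinite P)).trans hp
  refine ⟨S' ∪ (S ∩ P), T' ∪ (T ∩ P), ?_, ?_, exch_union hd (by simp) h3 exch_self⟩
  · exact (Set.ncard_union_le _ _).trans (Nat.add_le_add h1 (b S))
  · exact (Set.ncard_union_le _ _).trans (Nat.add_le_add h2 (b T))

/-- Bound for forests. -/
def bb (r : ℕ) : ℕ := NN (3 * r) 1 + 2 * r + 2 * (r + 1)

theorem sel_forest [Finite V] {G : SimpleGraph V} {A R S T : Set V} {r : ℕ}
    (hA : (inn G A).IsAcyclic) (hN : Nb G A R) (hRA : Disjoint R A) (hr : R.ncard ≤ r) :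
    ∃ S' T' : Set V, S'.ncard ≤ bb r ∧ T'.ncard ≤ bb r ∧ Exch G ∅ ∅ A S T S' T' := by
  have hb : ∀ X, IsMinFVS G X → (X ∩ A).ncard ≤ r := by
    intro X hX
    have h1 : IsFVS G ((X ∪ R) \ A ∪ ∅) := replace_fvs hN Set.subset_union_right
      (fvs_mono hX.1 Set.subset_union_left) (by simpa using hA)
    have h2 := hX.2 _ h1
    have h3 : ((X ∪ R) \ A ∪ ∅) ⊆ X \ A ∪ R := by
      rintro x (⟨hx | hx, hx2⟩ | hx)
      · exact Or.inl ⟨hx, hx2⟩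
      · exact Or.inr hx
      · exact absurd hx (Set.notMem_empty x)
    have h4 := Set.ncard_le_ncard h3 (Set.toFinite _)
    have h5 := Set.ncard_union_le (X \ A) R
    have h6 := ncard_split X A
    omega
  by_cases hS : r + 1 ≤ (S ∩ A).ncard
  · obtain ⟨S', hS', hc⟩ := Set.exists_subset_card_eq hS
    refine ⟨S', ∅, ?_, by simp, hS', Set.empty_subset _, ?_⟩
    · rw [hc]; unfold bb; omega
    · intro X hX _ T0 _ hSX _
      have h1 : S' ⊆ X ∩ A := fun x hx => ⟨hSX hx, (hS' hx).2⟩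
      have h2 := Set.ncard_le_ncard h1 (Set.toFinite _)
      have h3 := hb X hX
      omega
  rcases forest_ep (T := T) r A hA with ⟨P, hPA, hPc, hP⟩ | ⟨T', hT', hTc, hT⟩
  · set P1 : Set V := P ∪ (S ∩ A) with hP1
    have hP1A : P1 ⊆ A := Set.union_subset hPA Set.inter_subset_right
    have hP1c : P1.ncard ≤ 2 * r := (Set.ncard_union_le _ _).trans (by omega)
    have hD := sel_comps (G := G) (A := A \ P1) (R := R ∪ P1) (S := S) (T := T) (r := 3 * r)
      (n := 1) (by
        intro a ha b hab
        rcases hN a ha.1 b hab with h | h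
        · by_cases hbP : b ∈ P1
          · exact Or.inr (Or.inr hbP)
          · exact Or.inl ⟨h, hbP⟩
        · exact Or.inr (Or.inl h)) (by
        rw [Set.disjoint_left]
        rintro x (hx | hx) hx2
        · exact Set.disjoint_left.1 hRA hx hx2.1
        · exact hx2.2 hx) ((Set.ncard_union_le _ _).trans (by omega)) (by
        intro C
        refine ⟨S ∩ comp G (A \ P1) C, T ∩ comp G (A \ P1) C, ?_, ?_, exch_self⟩
        · have : S ∩ comp G (A \ P1) C = ∅ := by
            ext x
            simp only [Set.mem_inter_iff, Set.mem_empty_iff_false, iff_false, not_and]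
            intro hx hx2
            have := comp_sub C hx2
            exact this.2 (Or.inr ⟨hx, this.1⟩)
          rw [this]; simp
        · rw [Set.ncard_le_one_iff (Set.toFinite _)]
          intro a b ha hb
          refine hP a b ha.1 hb.1 ((comp_reach ha.2 hb.2).mono (inn_mono le_rfl ?_))
          exact fun x hx => ⟨hx.1, fun h => hx.2 (Or.inl h)⟩)
    obtain ⟨S', T', h1, h2, h3⟩ := sel_add (P := P1) (Set.disjoint_sdiff_left) hP1c hD
    rw [Set.sdiff_union_of_subset hP1A] at h3
    exact ⟨S', T', h1.trans (by unfold bb; omega), h2.trans (by unfold bb; omega), h3⟩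
  · refine ⟨∅, T', by simp, hTc.trans (by unfold bb; omega), Set.empty_subset _, hT', ?_⟩
    intro X hX _ T0 _ _ hs
    exfalso
    refine hT (X ∩ A) (hb X hX) ?_
    intro a b ha hb' hab
    refine (sep_iff.1 hs).2 a b (Or.inr ha) (Or.inr hb') (hab.mono (inn_mono le_rfl ?_))
    exact fun x hx h => hx.2 ⟨h, hx.1⟩

/-- The overall bound. -/
def ff : ℕ → ℕ → ℕ
  | 0, r => bb r
  | k + 1, r => bb r + NN r (ff k (r + 1) + 1)

theorem bb_le_ff (k r : ℕ) : bb r ≤ ff k r := by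
  cases k <;> simp [ff]

theorem sel_elim [Finite V] {G : SimpleGraph V} {A : Set V} {k : ℕ}
    (h : ElimLE G (fun A => (G.induce A).IsAcyclic) A k) : ∀ (R S T : Set V) (r : ℕ),
    Nb G A R → Disjoint R A → R.ncard ≤ r →
    ∃ S' T' : Set V, S'.ncard ≤ ff k r ∧ T'.ncard ≤ ff k r ∧ Exch G ∅ ∅ A S T S' T' := by
  induction h with
  | base A k h =>
    intro R S T r hN hRA hr
    obtain ⟨S', T', h1, h2, h3⟩ := sel_forest (S := S) (T := T) (induce_acyclic_iff.1 h) hN hRA hr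
    exact ⟨S', T', h1.trans (bb_le_ff k r), h2.trans (bb_le_ff k r), h3⟩
  | step A k v hv h ih =>
    intro R S T r hN hRA hr
    obtain ⟨S', T', h1, h2, h3⟩ := sel_comps (S := S) (T := T) (n := ff k (r + 1) + 1)
      hN hRA hr (by
        intro C
        have hvC : (v C).val ∈ comp G A C := ⟨v C, hv C, rfl⟩
        have := sel_add (D := comp G A C \ {(v C).val}) (P := {(v C).val}) (Set.disjoint_sdiff_left) (Set.ncard_singleton _).le
          (ih C (insert (v C).val R) S T (r + 1) (by
            intro a ha b hab
            rcases comp_nb hN C a ha.1 b hab with h | h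
            · by_cases e : b = (v C).val
              · exact Or.inr (Or.inl e)
              · exact Or.inl ⟨h, e⟩
            · exact Or.inr (Or.inr h)) (by
            rw [Set.disjoint_left]
            rintro x (hx | hx) hx2
            · exact hx2.2 hx
            · exact Set.disjoint_left.1 hRA hx (comp_sub C hx2.1))
            ((Set.ncard_insert_le _ _).trans (by omega)))
        rwa [Set.sdiff_union_of_subset (Set.singleton_subset_iff.2 hvC)] at this)
    exact ⟨S', T', h1.trans (by simp [ff]), h2.trans (by simp [ff]), h3⟩

theorem elim_exists [Finite V] {G : SimpleGraph V} (n : ℕ) : ∀ A : Set V, A.ncard ≤ n →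
    ElimLE G (fun A => (G.induce A).IsAcyclic) A n := by
  induction n with
  | zero =>
    intro A hA
    have : A = ∅ := by
      rw [← Set.ncard_eq_zero (Set.toFinite A)]; omega
    subst this
    exact ElimLE.base _ _ SimpleGraph.IsAcyclic.of_subsingleton
  | succ n ih =>
    intro A hA
    have hne : ∀ C : (G.induce A).ConnectedComponent, ∃ v, v ∈ C.supp := fun C => C.nonempty_supp
    choose v hv using hne
    refine ElimLE.step A n v hv (fun C => ih _ ?_)
    have hvC : (v C).val ∈ comp G A C := ⟨v C, hv C, rfl⟩
    have h1 : (comp G A C \ {(v C).val}).ncard < (comp G A C).ncard :=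
      Set.ncard_sdiff_singleton_lt_of_mem hvC (Set.toFinite _)
    have h2 := Set.ncard_le_ncard (comp_sub C) (Set.toFinite A)
    change (comp G A C \ {(v C).val}).ncard ≤ n
    omega

end forest

end FV

theorem stmt0 :
    ∃ γ : ℕ → ℕ,
      ∀ (V : Type) [Fintype V] (G : SimpleGraph V) (S T : Set V),
        G.Connected → Disjoint S T →
        (∀ X : Set V, IsMinFVS G X → BadFor G S T X) →
        ∃ S' T' : Set V, S' ⊆ S ∧ T' ⊆ T ∧
          S'.ncard ≤ γ (edForest G) ∧ T'.ncard ≤ γ (edForest G) ∧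
          ∀ X : Set V, IsMinFVS G X → BadFor G S' T' X := by
  classical
  refine ⟨fun k => FV.ff k 0, ?_⟩
  intro V _ G S T _ _ hbad
  have hmem : ElimLE G (fun A => (G.induce A).IsAcyclic) Set.univ (edForest G) :=
    Nat.sInf_mem (s := {k | ElimLE G (fun A => (G.induce A).IsAcyclic) Set.univ k})
      ⟨_, FV.elim_exists _ Set.univ le_rfl⟩
  obtain ⟨S', T', h1, h2, h3, h4, h5⟩ := FV.sel_elim hmem ∅ S T 0
    (fun a _ b _ => Or.inl (Set.mem_univ b)) (by simp) (by simp)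
  simp only [Set.inter_univ] at h3 h4 h5
  refine ⟨S', T', h3, h4, h1, h2, ?_⟩
  intro X hX
  by_contra hnb
  obtain ⟨hS, hT⟩ := (FV.not_badFor_iff hX.1).1 hnb
  obtain ⟨X', hX', -, hS', hT'⟩ := h5 X hX (by simp) ∅ (by simp) hS (by simpa using hT)
  exact (FV.not_badFor_iff hX'.1).2 ⟨hS', by simpa using hT'⟩ (hbad X' hX')
end

section
/- Let G be a connected graph with disjoint vertex sets S, T ⊆ V(G), and let (R, (B_u)_{u ∈ V(R)}) be a 𝒢F-elimination tree of G of height η. Suppose every minimum feedback vertex set X of G misses a vertex of S or leaves two vertices of T connected in G − X. Then there exist subsets S* ⊆ S and T* ⊆ T for which the same property holds and such that every vertex of the elimination tree R has at most 3η·2^η children u for which G_u contains a vertex of S* ∪ T*. -/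
/-- A `𝒢F`-elimination forest of `G` with node type `ι`: a rooted forest given by a
parent function (roots are their own parent, and iterating the parent function from any
node eventually reaches a root), together with bags that partition `V(G)`, such that
every non-leaf bag is a singleton, every leaf bag induces a connected forest, and the
endpoints of every edge of `G` lie in bags that are in ancestor-descendant relation. -/
structure ElimForestOn (V ι : Type) (G : SimpleGraph V) where
  parent : ι → ι
  bag : ι → Set V
  wf : ∀ u : ι, ∃ n : ℕ, parent^[n + 1] u = parent^[n] u
  bag_exists : ∀ v : V, ∃ u : ι, v ∈ bag u
  bag_unique : ∀ (v : V) (u w : ι), v ∈ bag u → v ∈ bag w → u = w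
  nonleaf_singleton : ∀ u : ι, (∃ c : ι, c ≠ u ∧ parent c = u) → ∃ x : V, bag u = {x}
  leaf_forest : ∀ u : ι, (∀ c : ι, parent c = u → c = u) → (G.induce (bag u)).IsAcyclic
  leaf_connected : ∀ u : ι, (∀ c : ι, parent c = u → c = u) → (G.induce (bag u)).Connected
  edge_anc : ∀ v w : V, G.Adj v w → ∀ s t : ι, v ∈ bag s → w ∈ bag t →
    (∃ n : ℕ, parent^[n] t = s) ∨ (∃ n : ℕ, parent^[n] s = t)

namespace ElimForestOn

variable {V ι : Type} {G : SimpleGraph V}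

/-- A node is a leaf when it has no (proper) children. -/
def IsLeaf (E : ElimForestOn V ι G) (u : ι) : Prop :=
  ∀ c : ι, E.parent c = u → c = u

/-- The elimination forest is a tree: it has a unique root. -/
def IsTree (E : ElimForestOn V ι G) : Prop :=
  (∃ r : ι, E.parent r = r) ∧ ∀ u v : ι, E.parent u = u → E.parent v = v → u = v

/-- `tree[c]`: the union of the bags of `c` and of all descendants of `c`. -/
def treeSet (E : ElimForestOn V ι G) (c : ι) : Set V :=
  {v | ∃ w : ι, (∃ n : ℕ, E.parent^[n] w = c) ∧ v ∈ E.bag w}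

/-- The depth of a node: the number of edges on the path to its root. -/
noncomputable def depth (E : ElimForestOn V ι G) (u : ι) : ℕ :=
  sInf {n | E.parent^[n + 1] u = E.parent^[n] u}

/-- The height of the elimination forest: the maximum depth of a node. -/
noncomputable def height (E : ElimForestOn V ι G) : ℕ :=
  sSup (Set.range E.depth)

end ElimForestOn


namespace FvsAux
open SimpleGraph

variable {V : Type}

/-- Spanning restriction of a graph to a vertex set. -/
def res (G : SimpleGraph V) (A : Set V) : SimpleGraph V where
  Adj v w := G.Adj v w ∧ v ∈ A ∧ w ∈ A
  symm := ⟨fun _ _ h => ⟨h.1.symm, h.2.2, h.2.1⟩⟩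
  loopless := ⟨fun _ h => h.1.ne rfl⟩

theorem res_adj {G : SimpleGraph V} {A : Set V} {v w : V} :
    (res G A).Adj v w ↔ G.Adj v w ∧ v ∈ A ∧ w ∈ A := Iff.rfl

theorem res_mono {G H : SimpleGraph V} {A B : Set V} (h : G ≤ H) (hAB : A ⊆ B) :
    res G A ≤ res H B := fun _ _ hh => ⟨h hh.1, hAB hh.2.1, hAB hh.2.2⟩

theorem reach_ind {H : SimpleGraph V} {x : V} {P : V → Prop} (h0 : P x)
    (hs : ∀ q q', H.Adj q q' → P q → P q') {y : V} (h : H.Reachable x y) : P y := by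
  rw [reachable_iff_reflTransGen] at h
  induction h with
  | refl => exact h0
  | tail _ h2 ih => exact hs _ _ h2 ih

theorem reach_step {H : SimpleGraph V} {x y z : V} (h : H.Reachable x y) (h2 : H.Adj y z) :
    H.Reachable x z := h.trans h2.reachable

theorem acyc_iff (H : SimpleGraph V) :
    H.IsAcyclic ↔ ∀ x y, H.Adj x y → ¬ (H.deleteEdges {s(x, y)}).Reachable x y := by
  rw [isAcyclic_iff_forall_adj_isBridge]
  rfl

theorem res_reach_mem {G : SimpleGraph V} {A : Set V} {x y : V} (hx : x ∈ A)
    (h : (res G A).Reachable x y) : y ∈ A :=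
  reach_ind (P := fun y => y ∈ A) hx (fun _ _ (hq : (res G A).Adj _ _) _ => hq.2.2) h

theorem induce_reach {G : SimpleGraph V} {A : Set V} {x y : V} (hx : x ∈ A) (hy : y ∈ A) :
    (G.induce A).Reachable ⟨x, hx⟩ ⟨y, hy⟩ ↔ (res G A).Reachable x y := by
  constructor
  · intro h
    exact h.map (G' := res G A) ⟨Subtype.val, fun {a b} hab => ⟨hab, a.2, b.2⟩⟩
  · intro h
    have : ∃ hy : y ∈ A, (G.induce A).Reachable ⟨x, hx⟩ ⟨y, hy⟩ := by
      refine reach_ind (P := fun y => ∃ hy : y ∈ A, (G.induce A).Reachable ⟨x, hx⟩ ⟨y, hy⟩)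
        ⟨hx, Reachable.refl _⟩ ?_ h
      rintro q q' hq ⟨hqA, hr⟩
      exact ⟨hq.2.2, reach_step hr (by exact hq.1)⟩
    exact this.2

theorem induce_acyc {G : SimpleGraph V} {A : Set V} :
    (G.induce A).IsAcyclic ↔ (res G A).IsAcyclic := by
  constructor
  · intro h
    rw [acyc_iff] at h ⊢
    intro x y hxy hr
    refine h ⟨x, hxy.2.1⟩ ⟨y, hxy.2.2⟩ hxy.1 ?_
    have : ∃ hy : y ∈ A, ((G.induce A).deleteEdges
        {s((⟨x, hxy.2.1⟩ : A), (⟨y, hxy.2.2⟩ : A))}).Reachable ⟨x, hxy.2.1⟩ ⟨y, hy⟩ := by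
      refine reach_ind (P := fun z => ∃ hy : z ∈ A, ((G.induce A).deleteEdges
        {s((⟨x, hxy.2.1⟩ : A), (⟨y, hxy.2.2⟩ : A))}).Reachable ⟨x, hxy.2.1⟩ ⟨z, hy⟩)
        ⟨hxy.2.1, Reachable.refl _⟩ ?_ hr
      rintro q q' hq ⟨hqA, hr⟩
      rw [deleteEdges_adj] at hq
      refine ⟨hq.1.2.2, reach_step hr ?_⟩
      rw [deleteEdges_adj]
      refine ⟨hq.1.1, ?_⟩
      have h2 := hq.2
      simp only [Set.mem_singleton_iff, Sym2.eq_iff, Subtype.mk.injEq] at h2 ⊢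
      exact h2
    exact this.2
  · intro h
    exact h.comap (G' := res G A) ⟨Subtype.val, fun {a b} hab => ⟨hab, a.2, b.2⟩⟩
      Subtype.val_injective

theorem no_cycle {G : SimpleGraph V} {K D : Set V} (hac : (res G K).IsAcyclic)
    {x y a b : V} (hx : x ∈ K ∩ D) (ha : a ∈ K \ D)
    (hxy : (res G (K ∩ D)).Reachable x y) (hab : (res G (K \ D)).Reachable a b)
    (hxa : G.Adj x a) (hyb : G.Adj y b) : x = y ∧ a = b := by
  by_contra hne
  have hy := res_reach_mem hx hxy
  have hb := res_reach_mem ha hab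
  refine (acyc_iff _).1 hac x a ⟨hxa, hx.1, ha.1⟩ ?_
  have h1 : ((res G K).deleteEdges {s(x, a)}).Reachable x y := by
    refine hxy.mono ?_
    intro p q hpq
    rw [deleteEdges_adj]
    refine ⟨⟨hpq.1, hpq.2.1.1, hpq.2.2.1⟩, ?_⟩
    have h1 := hpq.2.1.2
    have h2 := hpq.2.2.2
    have h3 := ha.2
    simp only [Set.mem_singleton_iff, Sym2.eq_iff]
    rintro (⟨rfl, rfl⟩ | ⟨rfl, rfl⟩) <;> contradiction
  have h2 : ((res G K).deleteEdges {s(x, a)}).Reachable b a := by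
    refine hab.symm.mono ?_
    intro p q hpq
    rw [deleteEdges_adj]
    refine ⟨⟨hpq.1, hpq.2.1.1, hpq.2.2.1⟩, ?_⟩
    have h1 := hpq.2.1.2
    have h2 := hpq.2.2.2
    have h3 := hx.2
    simp only [Set.mem_singleton_iff, Sym2.eq_iff]
    rintro (⟨rfl, rfl⟩ | ⟨rfl, rfl⟩) <;> contradiction
  have h3 : ((res G K).deleteEdges {s(x, a)}).Adj y b := by
    rw [deleteEdges_adj]
    refine ⟨⟨hyb, hy.1, hb.1⟩, ?_⟩
    simp only [Set.mem_singleton_iff, Sym2.eq_iff]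
    rintro (⟨rfl, rfl⟩ | ⟨rfl, rfl⟩)
    · exact hne ⟨rfl, rfl⟩
    · exact hb.2 hx.2
  exact (reach_step h1 h3).trans h2

/-- Every component of `G[P \ Y]` has at most one edge to `B`. -/
def OneEdge (G : SimpleGraph V) (B Q : Set V) : Prop :=
  ∀ x y a b, x ∈ Q → a ∈ B → b ∈ B → (res G Q).Reachable x y → G.Adj x a → G.Adj y b →
    x = y ∧ a = b

/-- Walks outside `P` can be made to avoid `P`. -/
theorem swap_out {G J : SimpleGraph V} {A P X Y : Set V}
    (hN : ∀ v w, v ∈ P → G.Adj v w → w ∈ P ∪ A)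
    (h1 : OneEdge G (A \ X) (P \ Y))
    (hJ : J ≤ res G (((X \ P) ∪ Y)ᶜ)) {p q : V} (hp : p ∉ P) (hr : J.Reachable p q) :
    (q ∉ P → (res J Pᶜ).Reachable p q) ∧ (q ∈ P → ∃ x a, x ∈ P \ Y ∧ a ∈ A \ X ∧ J.Adj x a ∧
      (res J Pᶜ).Reachable p a ∧ (res G (P \ Y)).Reachable x q) := by
  refine reach_ind (P := fun q => (q ∉ P → (res J Pᶜ).Reachable p q) ∧ (q ∈ P → ∃ x a,
    x ∈ P \ Y ∧ a ∈ A \ X ∧ J.Adj x a ∧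
      (res J Pᶜ).Reachable p a ∧ (res G (P \ Y)).Reachable x q)) ?_ ?_ hr
  · exact ⟨fun _ => Reachable.refl _, fun h => absurd h hp⟩
  · rintro q q' hqq ⟨ih1, ih2⟩
    obtain ⟨hG, hqK, hqK'⟩ := hJ hqq
    simp only [Set.mem_compl_iff, Set.mem_union, Set.mem_sdiff, not_or, not_and, not_not] at hqK hqK'
    constructor
    · intro hq'
      by_cases hq : q ∈ P
      · obtain ⟨x, a, hx, ha, hxa, hpa, hxq⟩ := ih2 hq
        have hq'A : q' ∈ A \ X := by
          refine ⟨(hN q q' hq hG).resolve_left hq', fun h => hq' (hqK'.1 h)⟩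
        obtain ⟨e1, e2⟩ := h1 x q a q' hx ha hq'A hxq (hJ hxa).1 hG
        rw [← e2]; exact hpa
      · exact reach_step (ih1 hq) ⟨hqq, hq, hq'⟩
    · intro hq'
      by_cases hq : q ∈ P
      · obtain ⟨x, a, hx, ha, hxa, hpa, hxq⟩ := ih2 hq
        exact ⟨x, a, hx, ha, hxa, hpa, reach_step hxq ⟨hG, ⟨hq, hqK.2⟩, ⟨hq', hqK'.2⟩⟩⟩
      · have hqA : q ∈ A \ X :=
          ⟨(hN q' q hq' hG.symm).resolve_left hq, fun h => hq (hqK.1 h)⟩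
        exact ⟨q', q, ⟨hq', hqK'.2⟩, hqA, hqq.symm, ih1 hq, Reachable.refl _⟩

theorem swap_in {G J : SimpleGraph V} {A P X Y : Set V}
    (hN : ∀ v w, v ∈ P → G.Adj v w → w ∈ P ∪ A)
    (h1 : OneEdge G (A \ X) (P \ Y))
    (hJ : J ≤ res G (((X \ P) ∪ Y)ᶜ)) {p q : V} (hp : p ∈ P) (hr : J.Reachable p q) :
    (q ∈ P ∧ (res J (P \ Y)).Reachable p q) ∨ (∃ x a, x ∈ P \ Y ∧ a ∈ A \ X ∧ G.Adj x a ∧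
      (res J (P \ Y)).Reachable p x ∧ (q ∈ P → ¬ (res G (P \ Y)).Reachable p q)) := by
  refine reach_ind (P := fun q => (q ∈ P ∧ (res J (P \ Y)).Reachable p q) ∨
    (∃ x a, x ∈ P \ Y ∧ a ∈ A \ X ∧ G.Adj x a ∧
      (res J (P \ Y)).Reachable p x ∧ (q ∈ P → ¬ (res G (P \ Y)).Reachable p q))) ?_ ?_ hr
  · exact Or.inl ⟨hp, Reachable.refl _⟩
  · rintro q q' hqq ih
    have hJG : J ≤ G := fun _ _ h => (hJ h).1
    obtain ⟨hG, hqK, hqK'⟩ := hJ hqq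
    simp only [Set.mem_compl_iff, Set.mem_union, Set.mem_sdiff, not_or, not_and, not_not] at hqK hqK'
    rcases ih with ⟨hq, hpq⟩ | ⟨x, a, hx, ha, hxa, hpx, hno⟩
    · by_cases hq' : q' ∈ P
      · exact Or.inl ⟨hq', reach_step hpq ⟨hqq, ⟨hq, hqK.2⟩, ⟨hq', hqK'.2⟩⟩⟩
      · exact Or.inr ⟨q, q', ⟨hq, hqK.2⟩, ⟨(hN q q' hq hG).resolve_left hq',
          fun h => hq' (hqK'.1 h)⟩, hG, hpq, fun h => absurd h hq'⟩
    · by_cases hq' : q' ∈ P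
      · by_cases hq : q ∈ P
        · refine Or.inr ⟨x, a, hx, ha, hxa, hpx, fun _ hr => hno hq ?_⟩
          exact reach_step hr ⟨hG.symm, ⟨hq', hqK'.2⟩, ⟨hq, hqK.2⟩⟩
        · by_cases hR : (res G (P \ Y)).Reachable p q'
          · have hqA : q ∈ A \ X :=
              ⟨(hN q' q hq' hG.symm).resolve_left hq, fun h => hq (hqK.1 h)⟩
            have hxq : (res G (P \ Y)).Reachable x q' :=
              (hpx.mono (res_mono hJG subset_rfl)).symm.trans hR
            obtain ⟨e1, e2⟩ := h1 x q' a q hx ha hqA hxq hxa hG.symm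
            exact Or.inl ⟨hq', e1 ▸ hpx⟩
          · exact Or.inr ⟨x, a, hx, ha, hxa, hpx, fun _ => hR⟩
      · exact Or.inr ⟨x, a, hx, ha, hxa, hpx, fun h => absurd h hq'⟩

theorem swap_acyc {G : SimpleGraph V} {A P X Y : Set V}
    (hN : ∀ v w, v ∈ P → G.Adj v w → w ∈ P ∪ A)
    (h1 : OneEdge G (A \ X) (P \ Y)) (hX : (res G Xᶜ).IsAcyclic)
    (hY : (res G (P \ Y)).IsAcyclic) : (res G (((X \ P) ∪ Y)ᶜ)).IsAcyclic := by
  rw [acyc_iff]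
  have key : ∀ x y, x ∉ P → (res G (((X \ P) ∪ Y)ᶜ)).Adj x y →
      ¬ ((res G (((X \ P) ∪ Y)ᶜ)).deleteEdges {s(x, y)}).Reachable x y := by
    intro x y hx hxy hr
    have hJ : (res G (((X \ P) ∪ Y)ᶜ)).deleteEdges {s(x, y)} ≤ res G (((X \ P) ∪ Y)ᶜ) :=
      deleteEdges_le _
    obtain ⟨i1, i2⟩ := swap_out hN h1 hJ hx hr
    obtain ⟨hG, hxK, hyK⟩ := hxy
    simp only [Set.mem_compl_iff, Set.mem_union, Set.mem_sdiff, not_or, not_and, not_not] at hxK hyK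
    by_cases hy : y ∈ P
    · obtain ⟨z, a, hz, ha, hza, -, hzy⟩ := i2 hy
      have hxA : x ∈ A \ X := ⟨(hN y x hy hG.symm).resolve_left hx, fun h => hx (hxK.1 h)⟩
      obtain ⟨e1, e2⟩ := h1 z y a x hz ha hxA hzy (hJ hza).1 hG.symm
      rw [deleteEdges_adj, e1, e2] at hza
      exact hza.2 (by simp [Sym2.eq_swap])
    · refine (acyc_iff _).1 hX x y ⟨hG, fun h => hx (hxK.1 h), fun h => hy (hyK.1 h)⟩ ?_
      refine (i1 hy).mono ?_
      rintro p q ⟨hpq, hp, hq⟩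
      rw [deleteEdges_adj] at hpq ⊢
      obtain ⟨⟨g, k1, k2⟩, g2⟩ := hpq
      refine ⟨⟨g, fun h => k1 (Or.inl ⟨h, hp⟩), fun h => k2 (Or.inl ⟨h, hq⟩)⟩, g2⟩
  intro x y hxy hr
  by_cases hx : x ∈ P
  · by_cases hy : y ∈ P
    · have hJ : (res G (((X \ P) ∪ Y)ᶜ)).deleteEdges {s(x, y)} ≤ res G (((X \ P) ∪ Y)ᶜ) :=
        deleteEdges_le _
      obtain ⟨hG, hxK, hyK⟩ := hxy
      have hadj : (res G (P \ Y)).Adj x y :=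
        ⟨hG, ⟨hx, fun h => hxK (Or.inr h)⟩, ⟨hy, fun h => hyK (Or.inr h)⟩⟩
      rcases swap_in hN h1 hJ hx hr with ⟨-, h⟩ | ⟨_, _, _, _, _, _, h⟩
      · refine (acyc_iff _).1 hY x y hadj (h.mono ?_)
        rintro p q ⟨hpq, hp, hq⟩
        rw [deleteEdges_adj] at hpq ⊢
        exact ⟨⟨hpq.1.1, hp, hq⟩, hpq.2⟩
      · exact h hy hadj.reachable
    · refine key y x hy hxy.symm ?_
      rw [Sym2.eq_swap]
      exact hr.symm
  · exact key x y hx hxy hr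

/-- Spanning version of separation. -/
def Sep (G : SimpleGraph V) (K T : Set V) : Prop :=
  ∀ t₁ t₂, t₁ ∈ K → t₂ ∈ K → t₁ ∈ T → t₂ ∈ T → (res G K).Reachable t₁ t₂ → t₁ = t₂

theorem sep_iff {G : SimpleGraph V} {K T : Set V} : SeparatedIn G K T ↔ Sep G K T := by
  constructor
  · intro h t₁ t₂ h1 h2 h3 h4 h5
    exact h t₁ t₂ h1 h2 h3 h4 ((induce_reach h1 h2).2 h5)
  · intro h t₁ t₂ h1 h2 h3 h4 h5
    exact h t₁ t₂ h1 h2 h3 h4 ((induce_reach h1 h2).1 h5)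

/-- Components of `G[Q]` with a vertex of `T` have no edge to `B`. -/
def NoTEdge (G : SimpleGraph V) (B Q T : Set V) : Prop :=
  ∀ t x a, t ∈ Q → t ∈ T → a ∈ B → (res G Q).Reachable t x → ¬ G.Adj x a

theorem swap_sep {G : SimpleGraph V} {A P X Y T : Set V}
    (hN : ∀ v w, v ∈ P → G.Adj v w → w ∈ P ∪ A)
    (h1 : OneEdge G (A \ X) (P \ Y)) (hsep : Sep G Xᶜ (T \ P))
    (h2 : NoTEdge G (A \ X) (P \ Y) T) (h3 : Sep G (P \ Y) T) :
    Sep G (((X \ P) ∪ Y)ᶜ) T := by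
  have key : ∀ t₁ t₂, t₁ ∈ P → t₁ ∈ ((X \ P) ∪ Y)ᶜ → t₂ ∈ ((X \ P) ∪ Y)ᶜ → t₁ ∈ T → t₂ ∈ T →
      (res G (((X \ P) ∪ Y)ᶜ)).Reachable t₁ t₂ → t₁ = t₂ := by
    intro t₁ t₂ hP k1 k2 hT1 hT2 hr
    have hq1 : t₁ ∈ P \ Y := ⟨hP, fun h => k1 (Or.inr h)⟩
    have hR : (res G (P \ Y)).Reachable t₁ t₂ := by
      refine reach_ind (P := fun q => (res G (P \ Y)).Reachable t₁ q) (Reachable.refl _) ?_ hr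
      rintro q q' ⟨hG, hk, hk'⟩ ih
      have hq := res_reach_mem hq1 ih
      by_cases hq' : q' ∈ P
      · exact reach_step ih ⟨hG, hq, ⟨hq', fun h => hk' (Or.inr h)⟩⟩
      · exact absurd hG (h2 t₁ q q' hq1 hT1 ⟨(hN q q' hq.1 hG).resolve_left hq',
          fun h => hk' (Or.inl ⟨h, hq'⟩)⟩ ih)
    exact h3 t₁ t₂ hq1 (res_reach_mem hq1 hR) hT1 hT2 hR
  intro t₁ t₂ k1 k2 hT1 hT2 hr
  by_cases hP1 : t₁ ∈ P
  · exact key t₁ t₂ hP1 k1 k2 hT1 hT2 hr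
  by_cases hP2 : t₂ ∈ P
  · exact (key t₂ t₁ hP2 k2 k1 hT2 hT1 hr.symm).symm
  refine hsep t₁ t₂ (fun h => k1 (Or.inl ⟨h, hP1⟩)) (fun h => k2 (Or.inl ⟨h, hP2⟩))
    ⟨hT1, hP1⟩ ⟨hT2, hP2⟩ ?_
  refine ((swap_out hN h1 le_rfl hP1 hr).1 hP2).mono ?_
  rintro p q ⟨⟨g, k1, k2⟩, hp, hq⟩
  exact ⟨g, fun h => k1 (Or.inl ⟨h, hp⟩), fun h => k2 (Or.inl ⟨h, hq⟩)⟩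

/-- Child `P` can be solved locally without interacting with `B`. -/
def Clean (G : SimpleGraph V) (B S T P : Set V) : Prop :=
  ∃ Y, Y ⊆ P ∧ (res G (P \ Y)).IsAcyclic ∧
    (∀ Z, Z ⊆ P → (res G (P \ Z)).IsAcyclic → Y.ncard ≤ Z.ncard) ∧
    S ∩ P ⊆ Y ∧ OneEdge G B (P \ Y) ∧ NoTEdge G B (P \ Y) T ∧ Sep G (P \ Y) T

theorem Clean.mono {G : SimpleGraph V} {B S T S' T' P : Set V} (h : Clean G B S T P)
    (hS : S' ⊆ S) (hT : T' ⊆ T) : Clean G B S' T' P := by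
  obtain ⟨Y, h1, h2, h3, h4, h5, h6, h7⟩ := h
  exact ⟨Y, h1, h2, h3, fun x hx => h4 ⟨hS hx.1, hx.2⟩, h5,
    fun t x a k1 k2 k3 k4 => h6 t x a k1 (hT k2) k3 k4,
    fun t s k1 k2 k3 k4 k5 => h7 t s k1 k2 (hT k3) (hT k4) k5⟩

/-- Minimum feedback vertex set, spanning version. -/
def MinF (G : SimpleGraph V) (X : Set V) : Prop :=
  (res G Xᶜ).IsAcyclic ∧ ∀ Y : Set V, (res G Yᶜ).IsAcyclic → X.ncard ≤ Y.ncard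

theorem minF_iff {G : SimpleGraph V} {X : Set V} : IsMinFVS G X ↔ MinF G X := by
  unfold IsMinFVS MinF IsFVS
  simp only [induce_acyc]

theorem swap_card [Finite V] {X P Y : Set V} {k : ℕ} (h : Y.ncard + k ≤ (X ∩ P).ncard) :
    ((X \ P) ∪ Y).ncard + k ≤ X.ncard := by
  have h1 := Set.ncard_union_le (X \ P) Y
  have h2 := Set.ncard_inter_add_ncard_sdiff_eq_ncard X P
  omega

theorem acyc_sub {G : SimpleGraph V} {K L : Set V} (h : (res G L).IsAcyclic) (hKL : K ⊆ L) :
    (res G K).IsAcyclic := h.anti (res_mono le_rfl hKL)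

theorem swap_step [Finite V] {G : SimpleGraph V} {A P X S T : Set V}
    (hN : ∀ v w, v ∈ P → G.Adj v w → w ∈ P ∪ A) (hA : Disjoint P A)
    (hX : MinF G X) (hS : S \ P ⊆ X) (hT : Sep G Xᶜ (T \ P))
    (hc : Clean G (A \ X) S T P) :
    ∃ X', MinF G X' ∧ S ⊆ X' ∧ Sep G X'ᶜ T ∧ A \ X' = A \ X := by
  obtain ⟨Y, h1, h2, h3, h4, h5, h6, h7⟩ := hc
  have hcard : ((X \ P) ∪ Y).ncard ≤ X.ncard := by
    refine swap_card (k := 0) (h3 (X ∩ P) Set.inter_subset_right (acyc_sub hX.1 ?_))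
    intro v hv hvX
    exact hv.2 ⟨hvX, hv.1⟩
  refine ⟨(X \ P) ∪ Y, ⟨swap_acyc hN h5 hX.1 h2, fun Z hZ => hcard.trans (hX.2 Z hZ)⟩, ?_,
    swap_sep hN h5 hT h6 h7, ?_⟩
  · intro v hv
    by_cases hvP : v ∈ P
    · exact Or.inr (h4 ⟨hv, hvP⟩)
    · exact Or.inl ⟨hS ⟨hv, hvP⟩, hvP⟩
  · ext v
    constructor
    · rintro ⟨hv, hn⟩
      exact ⟨hv, fun h => hn (Or.inl ⟨h, fun hp => hA.le_bot ⟨hp, hv⟩⟩)⟩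
    · rintro ⟨hv, hn⟩
      refine ⟨hv, ?_⟩
      rintro (h | h)
      · exact hn h.1
      · exact hA.le_bot ⟨h1 h, hv⟩

theorem swap_many [Finite V] {κ : Type} {G : SimpleGraph V} {A : Set V} {P : κ → Set V}
    (hN : ∀ c v w, v ∈ P c → G.Adj v w → w ∈ P c ∪ A) (hA : ∀ c, Disjoint (P c) A)
    {S T : Set V} (F : Finset κ) : ∀ X : Set V, MinF G X → S \ (⋃ c ∈ F, P c) ⊆ X →
      Sep G Xᶜ (T \ (⋃ c ∈ F, P c)) → (∀ c ∈ F, Clean G (A \ X) S T (P c)) →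
      ∃ X', MinF G X' ∧ S ⊆ X' ∧ Sep G X'ᶜ T := by
  classical
  induction F using Finset.induction_on with
  | empty =>
    intro X hX hS hT _
    exact ⟨X, hX, by simpa using hS, by simpa using hT⟩
  | insert c F hcF ih =>
    intro X hX hS hT hc
    have e : ∀ U : Set V, U \ (⋃ d ∈ insert c F, P d) = (U \ (⋃ d ∈ F, P d)) \ P c := by
      intro U
      rw [Finset.set_biUnion_insert, Set.union_comm, ← Set.sdiff_sdiff]
    rw [e] at hS hT
    obtain ⟨X', h1, h2, h3, h4⟩ := swap_step (hN c) (hA c) hX hS hT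
      ((hc c (Finset.mem_insert_self _ _)).mono Set.sdiff_subset Set.sdiff_subset)
    refine ih X' h1 h2 h3 ?_
    intro d hd
    rw [h4]
    exact hc d (Finset.mem_insert_of_mem hd)

theorem count_opt [Finite V] {κ : Type} {G : SimpleGraph V} {A : Set V} {P : κ → Set V}
    (hN : ∀ c v w, v ∈ P c → G.Adj v w → w ∈ P c ∪ A) (hA : ∀ c, Disjoint (P c) A)
    (hP : ∀ c d, c ≠ d → Disjoint (P c) (P d))
    {X : Set V} (hX : (res G Xᶜ).IsAcyclic) (F : Finset κ)
    (hF : ∀ c ∈ F, ∃ Z, Z ⊆ P c ∧ (res G (P c \ Z)).IsAcyclic ∧ Z.ncard < (X ∩ P c).ncard) :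
    ∃ X', A ⊆ X' ∧ (res G X'ᶜ).IsAcyclic ∧ X'.ncard + F.card ≤ X.ncard + (A \ X).ncard ∧
      ∀ c, c ∉ F → X' ∩ P c = X ∩ P c := by
  classical
  induction F using Finset.induction_on with
  | empty =>
    refine ⟨X ∪ A, Set.subset_union_right, acyc_sub hX ?_, ?_, ?_⟩
    · exact Set.compl_subset_compl.2 Set.subset_union_left
    · rw [← Set.union_sdiff_self]
      simpa using Set.ncard_union_le X (A \ X)
    · intro c _
      rw [Set.union_inter_distrib_right, Set.inter_comm A, (hA c).inter_eq, Set.union_empty]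
  | insert c F hcF ih =>
    obtain ⟨X', h1, h2, h3, h4⟩ := ih (fun d hd => hF d (Finset.mem_insert_of_mem hd))
    obtain ⟨Z, hZP, hZ, hZc⟩ := hF c (Finset.mem_insert_self _ _)
    refine ⟨(X' \ P c) ∪ Z, ?_, swap_acyc (A := A) (hN c) ?_ h2 hZ, ?_, ?_⟩
    · intro v hv
      exact Or.inl ⟨h1 hv, fun h => (hA c).le_bot ⟨h, hv⟩⟩
    · intro x y a b _ ha
      exact absurd (h1 ha.1) ha.2
    · have := swap_card (X := X') (P := P c) (Y := Z) (k := 1) (by rw [h4 c hcF]; omega)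
      rw [Finset.card_insert_of_notMem hcF]
      omega
    · intro d hd
      rw [Finset.mem_insert, not_or] at hd
      rw [← h4 d hd.2]
      have hdis := hP d c hd.1
      ext v
      constructor
      · rintro ⟨h | h, hv⟩
        · exact ⟨h.1, hv⟩
        · exact absurd (hZP h) (fun hh => hdis.le_bot ⟨hv, hh⟩)
      · rintro ⟨h, hv⟩
        exact ⟨Or.inl ⟨h, fun hh => hdis.le_bot ⟨hv, hh⟩⟩, hv⟩

theorem acyclic_card {W : Type} [Fintype W] [Nonempty W] (Q : SimpleGraph W) [Fintype Q.edgeSet]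
    (h : Q.IsAcyclic) :
    Q.edgeFinset.card + 1 ≤ Fintype.card W := by
  classical
  obtain ⟨T, h1, h2, h3⟩ := (connected_top (V := W)).exists_isTree_le_of_le_of_isAcyclic le_top h
  rw [← h3.card_edgeFinset]
  have := Finset.card_le_card (edgeFinset_mono h1)
  omega

theorem count_edges [Fintype V] {κ : Type} {G : SimpleGraph V} {A : Set V} {P : κ → Set V}
    (hA : ∀ c, Disjoint (P c) A)
    (hP : ∀ c d, c ≠ d → Disjoint (P c) (P d))
    {X : Set V} (hX : (res G Xᶜ).IsAcyclic) (F : Finset κ) (hne : (A \ X).Nonempty)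
    (hF : ∀ c ∈ F, ¬ OneEdge G (A \ X) (P c \ X)) :
    F.card + 1 ≤ (A \ X).ncard := by
  classical
  have hex : ∀ c : F, ∃ x y, ∃ a b : ↥(A \ X), x ∈ P c \ X ∧
      (res G (P c \ X)).Reachable x y ∧ G.Adj x a ∧ G.Adj y b ∧ ¬ (x = y ∧ a = b) := by
    rintro ⟨c, hc⟩
    have := hF c hc
    unfold OneEdge at this
    push Not at this
    obtain ⟨x, y, a, b, h1, h2, h3, h4, h5, h6, h7⟩ := this
    refine ⟨x, y, ⟨a, h2⟩, ⟨b, h3⟩, h1, h4, h5, h6, fun h => h7 h.1 ?_⟩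
    exact congrArg Subtype.val h.2
  choose x y a b hx hxy hxa hyb hno using hex
  have hne' : Nonempty ↥(A \ X) := hne.to_subtype
  -- no outside connection
  have hout : ∀ c : F, ¬ (res G (Xᶜ \ P c)).Reachable (a c : V) (b c) := by
    intro c hr
    have e1 : P c \ X = Xᶜ ∩ P c := by
      ext v; exact and_comm
    have hxc := hx c
    have hxyc := hxy c
    rw [e1] at hxc hxyc
    obtain ⟨e2, e3⟩ := no_cycle hX hxc
      ⟨(a c).2.2, fun h => (hA c).le_bot ⟨h, (a c).2.1⟩⟩ hxyc hr (hxa c) (hyb c)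
    exact hno c ⟨e2, Subtype.ext e3⟩
  have hin : ∀ c d : F, c ≠ d → (res G (Xᶜ \ P c)).Reachable (a d : V) (b d) := by
    intro c d hcd
    have hdis : Disjoint (P d) (P c) := hP d c (fun h => hcd (Subtype.ext h.symm))
    have hsub : P d \ X ⊆ Xᶜ \ P c := fun v hv => ⟨hv.2, fun h => hdis.le_bot ⟨hv.1, h⟩⟩
    have hmem : ∀ e : ↥(A \ X), (e : V) ∈ Xᶜ \ P c :=
      fun e => ⟨e.2.2, fun h => (hA c).le_bot ⟨h, e.2.1⟩⟩
    have hy := res_reach_mem (hx d) (hxy d)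
    have r1 : (res G (Xᶜ \ P c)).Adj (a d : V) (x d) := ⟨(hxa d).symm, hmem _, hsub (hx d)⟩
    have r2 : (res G (Xᶜ \ P c)).Adj (y d) (b d : V) := ⟨hyb d, hsub hy, hmem _⟩
    exact (r1.reachable.trans ((hxy d).mono (res_mono le_rfl hsub))).trans r2.reachable
  let Q : SimpleGraph ↥(A \ X) := fromEdgeSet (Set.range fun c : F => s(a c, b c))
  have hab : ∀ c, a c ≠ b c := by
    intro c h
    apply hout c
    rw [h]
  have hQadj : ∀ p q, Q.Adj p q → ∃ c : F, s(a c, b c) = s(p, q) := by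
    intro p q h
    rw [fromEdgeSet_adj] at h
    exact h.1
  have hinj : Function.Injective fun c : F => s(a c, b c) := by
    intro c d h
    by_contra hcd
    have h1 := hin c d hcd
    rcases Sym2.eq_iff.1 h with ⟨h2, h3⟩ | ⟨h2, h3⟩
    · rw [← h2, ← h3] at h1
      exact hout c h1
    · rw [← h2, ← h3] at h1
      exact hout c h1.symm
  have hQ : Q.IsAcyclic := by
    rw [acyc_iff]
    intro p q hpq hr
    obtain ⟨c, hc⟩ := hQadj p q hpq
    have hr' : (res G (Xᶜ \ P c)).Reachable (p : V) q := by
      refine reach_ind (P := fun z : ↥(A \ X) => (res G (Xᶜ \ P c)).Reachable (p : V) z)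
        (Reachable.refl _) ?_ hr
      intro z w hzw ih
      rw [deleteEdges_adj] at hzw
      obtain ⟨d, hd⟩ := hQadj z w hzw.1
      have hcd : c ≠ d := by
        rintro rfl
        exact hzw.2 (hd.symm.trans hc)
      refine ih.trans ?_
      have h1 := hin c d hcd
      rcases Sym2.eq_iff.1 hd with ⟨h2, h3⟩ | ⟨h2, h3⟩
      · rwa [h2, h3] at h1
      · rw [h2, h3] at h1
        exact h1.symm
    apply hout c
    rcases Sym2.eq_iff.1 hc with ⟨h2, h3⟩ | ⟨h2, h3⟩
    · rwa [h2, h3]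
    · rw [h2, h3]
      exact hr'.symm
  have hcard := acyclic_card Q hQ
  have hF2 : F.card ≤ Q.edgeFinset.card := by
    have : (Finset.univ.image fun c : F => s(a c, b c)) ⊆ Q.edgeFinset := by
      intro e he
      rw [Finset.mem_image] at he
      obtain ⟨c, -, rfl⟩ := he
      rw [mem_edgeFinset, mem_edgeSet, fromEdgeSet_adj]
      exact ⟨⟨c, rfl⟩, hab c⟩
    have h2 := Finset.card_le_card this
    rw [Finset.card_image_of_injective _ hinj] at h2
    simpa using h2
  rw [← Nat.card_coe_set_eq, Nat.card_eq_fintype_card]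
  omega

theorem count_T [Finite V] {κ : Type} {G : SimpleGraph V} {A T : Set V} {P : κ → Set V}
    (hP : ∀ c d, c ≠ d → Disjoint (P c) (P d))
    {X : Set V} (F : Finset κ) (hT : Sep G Xᶜ (T ∩ ⋃ c ∈ F, P c))
    (hF : ∀ c ∈ F, ¬ NoTEdge G (A \ X) (P c \ X) T) :
    F.card ≤ (A \ X).ncard := by
  classical
  have hex : ∀ c : F, ∃ t x a, t ∈ P c \ X ∧ t ∈ T ∧ a ∈ A \ X ∧
      (res G (P c \ X)).Reachable t x ∧ G.Adj x a := by
    rintro ⟨c, hc⟩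
    have := hF c hc
    unfold NoTEdge at this
    push Not at this
    exact this
  choose t x a ht htT ha htx hxa using hex
  have hsub : ∀ c : F, P c \ X ⊆ Xᶜ := fun c v hv => hv.2
  have hta : ∀ c : F, (res G Xᶜ).Reachable (t c) (a c) := by
    intro c
    have hx := res_reach_mem (ht c) (htx c)
    exact reach_step ((htx c).mono (res_mono le_rfl (hsub c))) ⟨hxa c, hx.2, (ha c).2⟩
  have hinj : Function.Injective a := by
    intro c d h
    by_contra hcd
    have hr : (res G Xᶜ).Reachable (t c) (t d) := by
      have h1 := hta d
      rw [← h] at h1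
      exact (hta c).trans h1.symm
    have hmem : ∀ c : F, t c ∈ T ∩ ⋃ c ∈ F, P c := fun c =>
      ⟨htT c, Set.mem_biUnion (x := (c : κ)) c.2 (ht c).1⟩
    have e := hT _ _ (ht c).2 (ht d).2 (hmem c) (hmem d) hr
    have h3 := (ht d).1
    rw [← e] at h3
    exact (hP c d (fun h => hcd (Subtype.ext h))).le_bot ⟨(ht c).1, h3⟩
  have : ((Finset.univ.image a : Finset V) : Set V) ⊆ A \ X := by
    intro v hv
    simp only [Finset.coe_image, Finset.coe_univ, Set.image_univ, Set.mem_range] at hv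
    obtain ⟨c, rfl⟩ := hv
    exact ha c
  have h2 := Set.ncard_le_ncard this (Set.toFinite _)
  rw [Set.ncard_coe_finset, Finset.card_image_of_injective _ hinj] at h2
  simpa using h2

theorem count_all [Fintype V] {κ : Type} {G : SimpleGraph V} {A S T : Set V} {P : κ → Set V}
    (hN : ∀ c v w, v ∈ P c → G.Adj v w → w ∈ P c ∪ A) (hA : ∀ c, Disjoint (P c) A)
    (hP : ∀ c d, c ≠ d → Disjoint (P c) (P d))
    {X : Set V} (hX : MinF G X) (M : Finset κ)
    (hS : ∀ c ∈ M, S ∩ P c ⊆ X) (hT : Sep G Xᶜ (T ∩ ⋃ c ∈ M, P c))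
    (hM : ∀ c ∈ M, ¬ Clean G (A \ X) S T (P c)) (η : ℕ) (hη : 1 ≤ η) (hAη : A.ncard ≤ η) :
    M.card < 3 * η := by
  classical
  let p1 : κ → Prop := fun c => ∃ Z, Z ⊆ P c ∧ (res G (P c \ Z)).IsAcyclic ∧
    Z.ncard < (X ∩ P c).ncard
  let p2 : κ → Prop := fun c => ¬ OneEdge G (A \ X) (P c \ X)
  let p3 : κ → Prop := fun c => ¬ NoTEdge G (A \ X) (P c \ X) T
  have hcover : ∀ c ∈ M, p1 c ∨ p2 c ∨ p3 c := by
    intro c hc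
    by_contra hno
    simp only [p1, p2, p3, not_or, not_not] at hno
    obtain ⟨h1, h2, h3⟩ := hno
    push Not at h1
    have e : P c \ (X ∩ P c) = P c \ X := by
      ext v
      exact ⟨fun h => ⟨h.1, fun hh => h.2 ⟨hh, h.1⟩⟩, fun h => ⟨h.1, fun hh => h.2 hh.1⟩⟩
    have hsub : P c \ X ⊆ Xᶜ := fun v hv => hv.2
    refine hM c hc ⟨X ∩ P c, Set.inter_subset_right, ?_, h1, ?_, ?_, ?_, ?_⟩
    · rw [e]; exact acyc_sub hX.1 hsub
    · exact fun v hv => ⟨hS c hc hv, hv.2⟩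
    · rwa [e]
    · rwa [e]
    · rw [e]
      intro t₁ t₂ k1 k2 k3 k4 k5
      exact hT t₁ t₂ k1.2 k2.2 ⟨k3, Set.mem_biUnion (x := c) hc k1.1⟩
        ⟨k4, Set.mem_biUnion (x := c) hc k2.1⟩ (k5.mono (res_mono le_rfl hsub))
  have hle : M.card ≤ (M.filter p1).card + (M.filter p2).card + (M.filter p3).card := by
    have : M ⊆ (M.filter p1 ∪ M.filter p2) ∪ M.filter p3 := by
      intro c hc
      simp only [Finset.mem_union, Finset.mem_filter]
      rcases hcover c hc with h | h | h
      · exact Or.inl (Or.inl ⟨hc, h⟩)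
      · exact Or.inl (Or.inr ⟨hc, h⟩)
      · exact Or.inr ⟨hc, h⟩
    have h1 := Finset.card_le_card this
    have h2 := Finset.card_union_le (M.filter p1 ∪ M.filter p2) (M.filter p3)
    have h3 := Finset.card_union_le (M.filter p1) (M.filter p2)
    omega
  have c1 : (M.filter p1).card ≤ (A \ X).ncard := by
    obtain ⟨X', -, h2, h3, -⟩ := count_opt hN hA hP hX.1 (M.filter p1)
      (fun c hc => (Finset.mem_filter.1 hc).2)
    have := hX.2 X' h2
    omega
  have c3 : (M.filter p3).card ≤ (A \ X).ncard := by
    refine count_T (G := G) (T := T) hP (M.filter p3) ?_ (fun c hc => (Finset.mem_filter.1 hc).2)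
    have hsub : T ∩ ⋃ c ∈ M.filter p3, P c ⊆ T ∩ ⋃ c ∈ M, P c := by
      refine Set.inter_subset_inter_right _ ?_
      exact Set.biUnion_subset_biUnion_left (fun c hc => (Finset.mem_filter.1 hc).1)
    exact fun t₁ t₂ k1 k2 k3 k4 k5 => hT t₁ t₂ k1 k2 (hsub k3) (hsub k4) k5
  have hAX : (A \ X).ncard ≤ A.ncard := Set.ncard_le_ncard Set.sdiff_subset (Set.toFinite _)
  rcases (A \ X).eq_empty_or_nonempty with h0 | h0
  · have c2 : (M.filter p2).card = 0 := by
      rw [Finset.card_eq_zero, Finset.filter_eq_empty_iff]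
      intro c _ h
      apply h
      intro x y a b _ ha
      rw [h0] at ha
      exact absurd ha (Set.notMem_empty _)
    have e0 : (A \ X).ncard = 0 := by rw [h0, Set.ncard_empty]
    omega
  · have c2 := count_edges hA hP hX.1 (M.filter p2) h0
      (fun c hc => (Finset.mem_filter.1 hc).2)
    omega

/-- Badness, spanning version. -/
def Bad (G : SimpleGraph V) (S T : Set V) : Prop :=
  ∀ X, MinF G X → ¬ (S ⊆ X ∧ Sep G Xᶜ T)

theorem bad_iff {G : SimpleGraph V} {S T : Set V} :
    (∀ X : Set V, IsMinFVS G X → BadFor G S T X) ↔ Bad G S T := by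
  unfold Bad BadFor
  refine forall_congr' fun X => ?_
  rw [minF_iff, sep_iff, not_and_or]

theorem node_step [Fintype V] {κ : Type} [Fintype κ] {G : SimpleGraph V} {A S T : Set V}
    {P : κ → Set V}
    (hN : ∀ c v w, v ∈ P c → G.Adj v w → w ∈ P c ∪ A) (hA : ∀ c, Disjoint (P c) A)
    (hP : ∀ c d, c ≠ d → Disjoint (P c) (P d))
    (η : ℕ) (hη : 1 ≤ η) (hAη : A.ncard ≤ η) (hbad : Bad G S T) :
    ∃ S' T' : Set V, S' ⊆ S ∧ T' ⊆ T ∧ Bad G S' T' ∧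
      ∃ M : Finset κ, M.card ≤ 3 * η * 2 ^ η ∧ ∀ c, c ∉ M → Disjoint (P c) (S' ∪ T') := by
  classical
  have hmark : ∀ B : Set V, ∃ M : Finset κ, (∀ c ∈ M, ¬ Clean G B S T (P c)) ∧ M.card ≤ 3 * η ∧
      (M.card < 3 * η → ∀ c, ¬ Clean G B S T (P c) → c ∈ M) := by
    intro B
    let N : Finset κ := Finset.univ.filter fun c => ¬ Clean G B S T (P c)
    rcases le_total N.card (3 * η) with h | h
    · exact ⟨N, fun c hc => (Finset.mem_filter.1 hc).2, h,
        fun _ c hc => Finset.mem_filter.2 ⟨Finset.mem_univ _, hc⟩⟩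
    · obtain ⟨M, hM, hMc⟩ := Finset.exists_subset_card_eq h
      exact ⟨M, fun c hc => (Finset.mem_filter.1 (hM hc)).2, hMc.le, fun h => by omega⟩
  choose mk hmk1 hmk2 hmk3 using hmark
  let M : Finset κ := A.toFinset.powerset.biUnion fun B => mk (B : Set V)
  have hMc : M.card ≤ 3 * η * 2 ^ η := by
    refine Finset.card_biUnion_le.trans ?_
    refine (Finset.sum_le_card_nsmul _ _ (3 * η) (fun B _ => hmk2 _)).trans ?_
    rw [Finset.card_powerset, smul_eq_mul, mul_comm, ← Set.ncard_eq_toFinset_card']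
    exact Nat.mul_le_mul_left _ (Nat.pow_le_pow_right (by norm_num) hAη)
  let F : Finset κ := Finset.univ \ M
  have hFM : ∀ c, c ∉ M → c ∈ F := fun c hc =>
    Finset.mem_sdiff.2 ⟨Finset.mem_univ _, hc⟩
  refine ⟨S \ ⋃ c ∈ F, P c, T \ ⋃ c ∈ F, P c, Set.sdiff_subset, Set.sdiff_subset, ?_, M, hMc, ?_⟩
  · rintro X hX ⟨hXS, hXT⟩
    let B : Set V := A \ X
    have hBM : mk B ⊆ M := by
      intro c hc
      refine Finset.mem_biUnion.2 ⟨B.toFinset, ?_, ?_⟩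
      · rw [Finset.mem_powerset]
        exact Set.toFinset_subset_toFinset.2 Set.sdiff_subset
      · rwa [Set.coe_toFinset]
    have hnotF : ∀ c ∈ mk B, ∀ v ∈ P c, v ∉ ⋃ d ∈ F, P d := by
      intro c hc v hv hvF
      simp only [Set.mem_iUnion] at hvF
      obtain ⟨d, hd, hvd⟩ := hvF
      have hcd : c ≠ d := by
        rintro rfl
        exact (Finset.mem_sdiff.1 hd).2 (hBM hc)
      exact (hP c d hcd).le_bot ⟨hv, hvd⟩
    have hlt : (mk B).card < 3 * η := by
      refine count_all (S := S) (T := T) hN hA hP hX (mk B) ?_ ?_ (hmk1 B) η hη hAη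
      · exact fun c hc v hv => hXS ⟨hv.1, hnotF c hc v hv.2⟩
      · have hsub : T ∩ ⋃ c ∈ mk B, P c ⊆ T \ ⋃ c ∈ F, P c := by
          rintro v ⟨hv, hvm⟩
          simp only [Set.mem_iUnion] at hvm
          obtain ⟨c, hc, hvc⟩ := hvm
          exact ⟨hv, hnotF c hc v hvc⟩
        exact fun t₁ t₂ k1 k2 k3 k4 k5 => hXT t₁ t₂ k1 k2 (hsub k3) (hsub k4) k5
    obtain ⟨X', h1, h2, h3⟩ := swap_many hN hA F X hX hXS hXT (by
      intro c hc
      by_contra hcl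
      exact (Finset.mem_sdiff.1 hc).2 (hBM (hmk3 B hlt c hcl)))
    exact hbad X' h1 ⟨h2, h3⟩
  · intro c hc
    rw [Set.disjoint_left]
    intro v hv hST
    have hvF : v ∈ ⋃ d ∈ F, P d := Set.mem_biUnion (x := c) (hFM c hc) hv
    rcases hST with h | h <;> exact h.2 hvF

section Tree

variable {ι : Type} {G : SimpleGraph V} (E : ElimForestOn V ι G)

theorem periodic_fixed {c : ι} {k : ℕ} (h : E.parent^[k + 1] c = c) : E.parent c = c := by
  obtain ⟨n, hn⟩ := E.wf c
  have h1 : ∀ m, E.parent^[m + n] c = E.parent^[n] c := by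
    intro m
    induction m with
    | zero => simp
    | succ m ih =>
      rw [show m + 1 + n = (m + n) + 1 by omega, Function.iterate_succ_apply', ih,
        ← Function.iterate_succ_apply' E.parent, hn]
  have h2 : E.parent^[(k + 1) * n] c = c := by
    rw [Function.iterate_mul]
    exact Function.iterate_fixed h n
  have h3 := h1 (k * n)
  rw [show k * n + n = (k + 1) * n by ring, h2] at h3
  rw [Function.iterate_succ_apply', ← h3] at hn
  exact hn

/-- Union of the bags of the ancestors of `u` (including `u`). -/
def ancSet (u : ι) : Set V := {v | ∃ n : ℕ, v ∈ E.bag (E.parent^[n] u)}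

theorem tree_disj {u c d : ι} (hc : E.parent c = u) (hcu : c ≠ u) (hd : E.parent d = u)
    (hdu : d ≠ u) (hcd : c ≠ d) : Disjoint (E.treeSet c) (E.treeSet d) := by
  have key : ∀ (c d : ι), E.parent c = u → E.parent d = u → d ≠ u → c ≠ d → ∀ w n m,
      E.parent^[n] w = c → E.parent^[m] w = d → n ≤ m → False := by
    intro c d hc hd hdu hcd w n m hn hm hnm
    obtain ⟨k, rfl⟩ := Nat.exists_eq_add_of_le' hnm
    rw [Function.iterate_add_apply, hn] at hm
    cases k with
    | zero => exact hcd hm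
    | succ k =>
      rw [Function.iterate_succ_apply, hc, ← hd, ← Function.iterate_succ_apply] at hm
      exact hdu ((periodic_fixed E hm).symm.trans hd)
  rw [Set.disjoint_left]
  rintro v ⟨w, ⟨n, hn⟩, hv⟩ ⟨w', ⟨m, hm⟩, hv'⟩
  obtain rfl := E.bag_unique v w w' hv hv'
  rcases le_total n m with h | h
  · exact key c d hc hd hdu hcd w n m hn hm h
  · exact key d c hd hc hcu hcd.symm w m n hm hn h

theorem tree_anc_disj {u c : ι} (hc : E.parent c = u) (hcu : c ≠ u) :
    Disjoint (E.treeSet c) (ancSet E u) := by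
  rw [Set.disjoint_left]
  rintro v ⟨w, ⟨n, hn⟩, hv⟩ ⟨m, hv'⟩
  obtain rfl := E.bag_unique v w _ hv hv'
  rw [← Function.iterate_add_apply, ← hc, ← Function.iterate_succ_apply] at hn
  exact hcu ((periodic_fixed E hn).symm.trans hc)

theorem tree_nbr {u c : ι} (hc : E.parent c = u) (v w : V) (hv : v ∈ E.treeSet c)
    (hvw : G.Adj v w) : w ∈ E.treeSet c ∪ ancSet E u := by
  obtain ⟨s, ⟨n, hn⟩, hvs⟩ := hv
  obtain ⟨t, hwt⟩ := E.bag_exists w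
  rcases E.edge_anc v w hvw s t hvs hwt with ⟨m, hm⟩ | ⟨m, hm⟩
  · left
    exact ⟨t, ⟨n + m, by rw [Function.iterate_add_apply, hm, hn]⟩, hwt⟩
  · rcases le_or_gt m n with h | h
    · left
      refine ⟨t, ⟨n - m, ?_⟩, hwt⟩
      rw [← hm, ← Function.iterate_add_apply, Nat.sub_add_cancel h, hn]
    · right
      obtain ⟨k, rfl⟩ := Nat.exists_eq_add_of_lt h
      refine ⟨k, ?_⟩
      rw [show n + k + 1 = k + 1 + n by omega, Function.iterate_add_apply, hn,
        Function.iterate_succ_apply, hc] at hm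
      rwa [hm]

theorem anc_card [Fintype V] [Fintype ι] {u c : ι} (hc : E.parent c = u) (hcu : c ≠ u) :
    1 ≤ E.height ∧ (ancSet E u).ncard ≤ E.height := by
  classical
  have hdu : E.depth u + 1 ≤ E.depth c := by
    have hmem : E.depth c ∈ {n | E.parent^[n + 1] c = E.parent^[n] c} := Nat.sInf_mem (E.wf c)
    rcases hk : E.depth c with _ | m
    · rw [hk] at hmem
      exact absurd (hmem.symm.trans hc) hcu
    · rw [hk] at hmem
      have : E.depth u ≤ m := by
        refine Nat.sInf_le ?_
        have h2 : E.parent^[m + 1 + 1] c = E.parent^[m + 1] c := hmem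
        rw [Function.iterate_succ_apply E.parent (m + 1) c,
          Function.iterate_succ_apply E.parent m c, hc] at h2
        exact h2
      omega
  have hch : E.depth c ≤ E.height := le_csSup (Set.finite_range _).bddAbove ⟨c, rfl⟩
  refine ⟨by omega, le_trans ?_ (hdu.trans hch)⟩
  have hnl : ∀ n, ∃ d, d ≠ E.parent^[n] u ∧ E.parent d = E.parent^[n] u := by
    intro n
    induction n with
    | zero => exact ⟨c, hcu, hc⟩
    | succ n ih =>
      rw [Function.iterate_succ_apply']
      by_cases h : E.parent (E.parent^[n] u) = E.parent^[n] u
      · rw [h]; exact ih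
      · exact ⟨_, fun hh => h hh.symm, rfl⟩
  have hsing : ∀ n, ∃ x, E.bag (E.parent^[n] u) = {x} := fun n => E.nonleaf_singleton _ (hnl n)
  choose f hf using hsing
  have hfix : E.parent^[E.depth u + 1] u = E.parent^[E.depth u] u := Nat.sInf_mem (E.wf u)
  have hconst : ∀ k, E.parent^[k + E.depth u] u = E.parent^[E.depth u] u := by
    intro k
    induction k with
    | zero => simp
    | succ k ih =>
      rw [show k + 1 + E.depth u = (k + E.depth u) + 1 by omega, Function.iterate_succ_apply', ih,
        ← Function.iterate_succ_apply' E.parent, hfix]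
  have hsub : ancSet E u ⊆ ((Finset.range (E.depth u + 1)).image f : Finset V) := by
    rintro v ⟨n, hn⟩
    rw [Finset.coe_image]
    rcases le_total n (E.depth u) with h | h
    · refine ⟨n, ?_, ?_⟩
      · simp only [Finset.coe_range, Set.mem_Iio]; omega
      · rw [hf n] at hn; exact hn.symm
    · refine ⟨E.depth u, ?_, ?_⟩
      · simp
      · rw [← Nat.sub_add_cancel h, hconst, hf] at hn; exact hn.symm
  have h1 := Set.ncard_le_ncard hsub (Set.toFinite _)
  rw [Set.ncard_coe_finset] at h1
  refine h1.trans (Finset.card_image_le.trans ?_)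
  simp

theorem node_bound [Fintype V] [Fintype ι] (u : ι) {S T : Set V} (hbad : Bad G S T) :
    ∃ S' T' : Set V, S' ⊆ S ∧ T' ⊆ T ∧ Bad G S' T' ∧
      {c : ι | E.parent c = u ∧ c ≠ u ∧ ((E.treeSet c) ∩ (S' ∪ T')).Nonempty}.ncard
          ≤ 3 * E.height * 2 ^ E.height := by
  classical
  by_cases hex : ∃ c, E.parent c = u ∧ c ≠ u
  · obtain ⟨c, hc, hcu⟩ := hex
    obtain ⟨hη, hAη⟩ := anc_card E hc hcu
    obtain ⟨S', T', h1, h2, h3, M, h4, h5⟩ := node_step (G := G) (S := S) (T := T)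
      (κ := {c : ι // E.parent c = u ∧ c ≠ u})
      (A := ancSet E u) (P := fun c => E.treeSet c)
      (fun c => tree_nbr E c.2.1) (fun c => tree_anc_disj E c.2.1 c.2.2)
      (fun c d hcd => tree_disj E c.2.1 c.2.2 d.2.1 d.2.2 (fun h => hcd (Subtype.ext h)))
      E.height hη hAη hbad
    refine ⟨S', T', h1, h2, h3, le_trans ?_ h4⟩
    have hsub : {c : ι | E.parent c = u ∧ c ≠ u ∧ ((E.treeSet c) ∩ (S' ∪ T')).Nonempty} ⊆
        ((M.image Subtype.val : Finset ι) : Set ι) := by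
      rintro d ⟨hd, hdu, hne⟩
      rw [Finset.coe_image]
      refine ⟨⟨d, hd, hdu⟩, ?_, rfl⟩
      by_contra hM
      exact Set.not_disjoint_iff_nonempty_inter.2 hne (h5 ⟨d, hd, hdu⟩ hM)
    have h6 := Set.ncard_le_ncard hsub (Set.toFinite _)
    rw [Set.ncard_coe_finset] at h6
    exact h6.trans Finset.card_image_le
  · refine ⟨S, T, subset_rfl, subset_rfl, hbad, ?_⟩
    have : {c : ι | E.parent c = u ∧ c ≠ u ∧ ((E.treeSet c) ∩ (S ∪ T)).Nonempty} = ∅ := by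
      ext c
      simp only [Set.mem_ofPred_eq, Set.mem_empty_iff_false, iff_false]
      rintro ⟨h1, h2, -⟩
      exact hex ⟨c, h1, h2⟩
    rw [this, Set.ncard_empty]
    exact Nat.zero_le _

theorem all_nodes [Fintype V] [Fintype ι] {S T : Set V} (hbad : Bad G S T) (F : Finset ι) :
    ∃ S' T' : Set V, S' ⊆ S ∧ T' ⊆ T ∧ Bad G S' T' ∧ ∀ u ∈ F,
      {c : ι | E.parent c = u ∧ c ≠ u ∧ ((E.treeSet c) ∩ (S' ∪ T')).Nonempty}.ncard
          ≤ 3 * E.height * 2 ^ E.height := by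
  classical
  induction F using Finset.induction_on with
  | empty => exact ⟨S, T, subset_rfl, subset_rfl, hbad, by simp⟩
  | insert u F _ ih =>
    obtain ⟨S1, T1, a1, a2, a3, a4⟩ := ih
    obtain ⟨S2, T2, b1, b2, b3, b4⟩ := node_bound E u a3
    refine ⟨S2, T2, b1.trans a1, b2.trans a2, b3, ?_⟩
    intro w hw
    rcases Finset.mem_insert.1 hw with rfl | hw
    · exact b4
    · refine le_trans (Set.ncard_le_ncard ?_ (Set.toFinite _)) (a4 w hw)
      rintro c ⟨h1, h2, h3⟩
      exact ⟨h1, h2, h3.mono (Set.inter_subset_inter_right _ (Set.union_subset_union b1 b2))⟩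

end Tree

end FvsAux

theorem stmt1 (V ι : Type) [Fintype V] [Fintype ι] (G : SimpleGraph V)
    (E : ElimForestOn V ι G) (htree : E.IsTree) (η : ℕ) (hη : E.height = η)
    (S T : Set V) (hconn : G.Connected) (hdisj : Disjoint S T)
    (hbad : ∀ X : Set V, IsMinFVS G X → BadFor G S T X) :
    ∃ S' T' : Set V, S' ⊆ S ∧ T' ⊆ T ∧
      (∀ X : Set V, IsMinFVS G X → BadFor G S' T' X) ∧
      ∀ u : ι,
        {c : ι | E.parent c = u ∧ c ≠ u ∧ ((E.treeSet c) ∩ (S' ∪ T')).Nonempty}.ncard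
          ≤ 3 * η * 2 ^ η := by
  obtain ⟨S', T', h1, h2, h3, h4⟩ := FvsAux.all_nodes E (FvsAux.bad_iff.1 hbad) Finset.univ
  refine ⟨S', T', h1, h2, FvsAux.bad_iff.2 h3, fun u => ?_⟩
  rw [← hη]
  exact h4 u (Finset.mem_univ u)
end
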